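/- arXiv:1511.05735 — 3 statements merged into one kernel-verified Lean document; each statement's English description precedes it below -/
import Mathlib

section
/- Let t0 < t1 be reals and a, b ∈ ℝ. Let B = (B_t)_{t∈[t0,t1]} be a Brownian bridge from (t0,a) to (t1,b): a process with almost surely continuous paths whose finite-dimensional distributions are multivariate Gaussian with mean E[B_t] = a + ((t−t0)/(t1−t0))(b−a) and covariance Cov(B_s, B_t) = (s−t0)(t1−t)/(t1−t0) for t0 ≤ s ≤ t ≤ t1. Then the law of m(B) := min_{t∈[t0,t1]} B_t is absolutely continuous with respect to Lebesgue measure, with density f(y) = (2/(t1−t0)) · (a + b − 2y) · exp(−2(a−y)(b−y)/(t1−t0)) for y < min(a,b), and f(y) = 0 for y ≥ min(a,b). -/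
open MeasureTheory ProbabilityTheory Real
open scoped ENNReal NNReal

/-- first passage above level `1` at step `k` -/
def fstHit {Ω : Type*} (M : ℕ → Ω → ℝ≥0∞) (k : ℕ) : Set Ω :=
  {ω | (∀ j < k, M j ω < 1) ∧ 1 ≤ M k ω}

lemma fstHit_meas {Ω : Type*} [MeasurableSpace Ω] (M : ℕ → Ω → ℝ≥0∞)
    (hM : ∀ k, Measurable (M k)) (k : ℕ) : MeasurableSet (fstHit M k) := by
  have : fstHit M k = (⋂ j ∈ Finset.range k, {ω | M j ω < 1}) ∩ {ω | 1 ≤ M k ω} := by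
    ext ω; simp [fstHit]
  rw [this]
  refine MeasurableSet.inter ?_ (measurableSet_le measurable_const (hM k))
  exact Finset.measurableSet_biInter _ (fun j _ => measurableSet_lt (hM j) measurable_const)

lemma fstHit_disj {Ω : Type*} (M : ℕ → Ω → ℝ≥0∞) (I : Set ℕ) :
    I.PairwiseDisjoint (fstHit M) := by
  intro i _ j _ hij
  refine Set.disjoint_left.2 ?_
  rintro ω ⟨h1, h2⟩ ⟨h3, h4⟩
  rcases lt_or_gt_of_ne hij with h | h
  · exact absurd h2 (not_le.2 (h3 _ h))
  · exact absurd h4 (not_le.2 (h1 _ h))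

lemma fstHit_union {Ω : Type*} (M : ℕ → Ω → ℝ≥0∞) (N : ℕ) :
    (⋃ k ∈ Finset.range (N+1), fstHit M k) = {ω | ∃ k ≤ N, 1 ≤ M k ω} := by
  ext ω
  simp only [Finset.mem_range, Set.mem_iUnion, Set.mem_ofPred_eq, fstHit, exists_prop]
  constructor
  · rintro ⟨k, hk, -, h⟩
    exact ⟨k, by omega, h⟩
  · rintro ⟨k, hk, h⟩
    classical
    have hex : ∃ k, 1 ≤ M k ω := ⟨k, h⟩
    refine ⟨Nat.find hex, ?_, ?_, Nat.find_spec hex⟩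
    · have := Nat.find_min' hex h
      omega
    · intro j hj
      exact not_le.1 (Nat.find_min hex hj)

lemma discrete_upper {Ω : Type*} [MeasurableSpace Ω] (P : Measure Ω)
    (M : ℕ → Ω → ℝ≥0∞) (hM : ∀ k, Measurable (M k)) (N : ℕ)
    (H1 : ∀ k ≤ N, ∫⁻ ω in fstHit M k, M k ω ∂P = ∫⁻ ω in fstHit M k, M N ω ∂P) :
    P {ω | ∃ k ≤ N, 1 ≤ M k ω} ≤ ∫⁻ ω, M N ω ∂P := by
  rw [← fstHit_union, measure_biUnion_finset (fstHit_disj _ _) (fun k _ => fstHit_meas M hM k)]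
  calc ∑ k ∈ Finset.range (N+1), P (fstHit M k)
      ≤ ∑ k ∈ Finset.range (N+1), ∫⁻ ω in fstHit M k, M N ω ∂P := by
        refine Finset.sum_le_sum fun k hk => ?_
        rw [← H1 k (by simp at hk; omega), ← setLIntegral_one]
        exact setLIntegral_mono (hM k) (fun ω hω => hω.2)
    _ = ∫⁻ ω in ⋃ k ∈ Finset.range (N+1), fstHit M k, M N ω ∂P :=
        (lintegral_biUnion_finset (fstHit_disj _ _) (fun k _ => fstHit_meas M hM k) _).symm
    _ ≤ _ := setLIntegral_le_lintegral _ _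

lemma discrete_lower {Ω : Type*} [MeasurableSpace Ω] (P : Measure Ω)
    (M : ℕ → Ω → ℝ≥0∞) (hM : ∀ k, Measurable (M k)) (N : ℕ)
    (H1 : ∀ k ≤ N, ∫⁻ ω in fstHit M k, M k ω ∂P = ∫⁻ ω in fstHit M k, M N ω ∂P)
    (H2 : ∀ k ≤ N, ∫⁻ ω in fstHit M k, M k ω ^ 2 ∂P ≤ ∫⁻ ω in fstHit M k, M N ω ^ 2 ∂P)
    (ε K : ℝ≥0∞) (hK0 : K ≠ 0) (hK : K ≠ ∞) :
    ∫⁻ ω, M N ω ∂P ≤ (1 + ε) * P {ω | ∃ k ≤ N, 1 ≤ M k ω}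
      + K * P {ω | ∃ k ≤ N, ω ∈ fstHit M k ∧ 1 + ε < M k ω}
      + K⁻¹ * ∫⁻ ω, M N ω ^ 2 ∂P + ∫⁻ ω, min (M N ω) 1 ∂P := by
  set E : Set Ω := {ω | ∃ k ≤ N, 1 ≤ M k ω} with hE
  set G : Set Ω := {ω | ∃ k ≤ N, ω ∈ fstHit M k ∧ 1 + ε < M k ω} with hG
  have hEm : MeasurableSet E := by
    rw [hE, ← fstHit_union]
    exact Finset.measurableSet_biUnion _ (fun k _ => fstHit_meas M hM k)
  have hGm : MeasurableSet G := by
    have : G = ⋃ k ∈ Finset.range (N+1), fstHit M k ∩ {ω | 1 + ε < M k ω} := by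
      ext ω; simp only [hG, Finset.mem_range, Set.mem_iUnion, Set.mem_inter_iff, Set.mem_ofPred_eq, exists_prop, Nat.lt_succ_iff]
    rw [this]
    exact Finset.measurableSet_biUnion _
      (fun k _ => (fstHit_meas M hM k).inter (measurableSet_lt measurable_const (hM k)))
  have hpt : ∀ k ≤ N, ∀ ω ∈ fstHit M k, M k ω ≤ (1 + ε) + G.indicator (fun _ => K) ω
      + K⁻¹ * M k ω ^ 2 := by
    intro k hk ω hω
    by_cases h : M k ω ≤ 1 + ε
    · exact h.trans (by rw [add_assoc]; exact le_self_add)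
    · have hωG : ω ∈ G := ⟨k, hk, hω, not_le.1 h⟩
      rw [Set.indicator_of_mem hωG]
      by_cases h2 : M k ω ≤ K
      · exact h2.trans ((le_add_self).trans le_self_add)
      · refine le_trans ?_ le_add_self
        calc M k ω = K⁻¹ * (K * M k ω) := by
              rw [← mul_assoc, ENNReal.inv_mul_cancel hK0 hK, one_mul]
          _ ≤ K⁻¹ * M k ω ^ 2 := by
              rw [pow_two]; gcongr; exact (not_le.1 h2).le
  rw [← lintegral_add_compl _ hEm]
  gcongr ?_ + ?_
  · calc ∫⁻ ω in E, M N ω ∂P = ∑ k ∈ Finset.range (N+1), ∫⁻ ω in fstHit M k, M N ω ∂P := by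
          rw [hE, ← fstHit_union]
          exact lintegral_biUnion_finset (fstHit_disj _ _) (fun k _ => fstHit_meas M hM k) _
      _ ≤ ∑ k ∈ Finset.range (N+1), ∫⁻ ω in fstHit M k,
            ((1 + ε) + G.indicator (fun _ => K) ω + K⁻¹ * M N ω ^ 2) ∂P := by
          refine Finset.sum_le_sum fun k hk => ?_
          have hk' : k ≤ N := by simp at hk; omega
          rw [← H1 k hk']
          have hm : Measurable (fun ω => (1 + ε) + G.indicator (fun _ => K) ω) :=
            measurable_const.add (measurable_const.indicator hGm)
          calc _ ≤ ∫⁻ ω in fstHit M k,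
                ((1 + ε) + G.indicator (fun _ => K) ω + K⁻¹ * M k ω ^ 2) ∂P :=
                setLIntegral_mono' (fstHit_meas M hM k) (hpt k hk')
            _ ≤ _ := by
                rw [lintegral_add_left hm, lintegral_add_left hm,
                  lintegral_const_mul _ ((hM _).pow_const 2),
                  lintegral_const_mul _ ((hM _).pow_const 2)]
                exact add_le_add le_rfl (mul_le_mul_right (H2 k hk') _)
      _ = ∫⁻ ω in E, ((1 + ε) + G.indicator (fun _ => K) ω + K⁻¹ * M N ω ^ 2) ∂P := by
          rw [hE, ← fstHit_union]
          exact (lintegral_biUnion_finset (fstHit_disj _ _)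
            (fun k _ => fstHit_meas M hM k) _).symm
      _ ≤ _ := by
          have hm : Measurable (fun ω => (1 + ε) + G.indicator (fun _ => K) ω) :=
            measurable_const.add (measurable_const.indicator hGm)
          rw [lintegral_add_left hm,
            lintegral_add_left measurable_const, lintegral_const_mul _ ((hM _).pow_const 2)]
          gcongr
          · simp
          · refine (setLIntegral_le_lintegral _ _).trans ?_
            rw [lintegral_indicator_const hGm]
          · exact Measure.restrict_le_self
  · calc ∫⁻ ω in Eᶜ, M N ω ∂P ≤ ∫⁻ ω in Eᶜ, min (M N ω) 1 ∂P := by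
          refine setLIntegral_mono' hEm.compl fun ω hω => ?_
          refine le_min le_rfl ?_
          by_contra hc
          exact hω ⟨N, le_rfl, (not_le.1 hc).le⟩
      _ ≤ _ := setLIntegral_le_lintegral _ _

/-- Brownian bridge from `(t0,a)` to `(t1,b)` (bundled hypotheses). -/
structure IsBB {Ω : Type*} [MeasurableSpace Ω] (P : Measure Ω)
    (t0 t1 a b : ℝ) (B : ℝ → Ω → ℝ) : Prop where
  ht : t0 < t1
  hmeas : ∀ t, Measurable (B t)
  hcont : ∀ᵐ ω ∂P, ContinuousOn (fun t => B t ω) (Set.Icc t0 t1)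
  hgauss : ∀ (n : ℕ) (ts : Fin n → ℝ) (c : Fin n → ℝ),
      (∀ i, ts i ∈ Set.Icc t0 t1) →
      P.map (fun ω => ∑ i, c i * B (ts i) ω) =
        gaussianReal
          (∑ i, c i * (a + (ts i - t0) / (t1 - t0) * (b - a)))
          (Real.toNNReal (∑ i, ∑ j, c i * c j *
            ((min (ts i) (ts j) - t0) * (t1 - max (ts i) (ts j)) / (t1 - t0))))

section BB
set_option linter.unusedSectionVars false
variable {Ω : Type*} [MeasurableSpace Ω] {P : Measure Ω} [IsProbabilityMeasure P]
  {t0 t1 a b : ℝ} {B : ℝ → Ω → ℝ}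

lemma IsBB.gauss_vec (h : IsBB P t0 t1 a b B) (n : ℕ) (ts : Fin n → ℝ)
    (hts : ∀ i, ts i ∈ Set.Icc t0 t1) :
    HasGaussianLaw (fun ω (i : Fin n) => B (ts i) ω) P := by
  refine ⟨isGaussian_of_map_eq_gaussianReal fun L => ?_⟩
  have hm : Measurable (fun ω (i : Fin n) => B (ts i) ω) :=
    measurable_pi_lambda _ (fun i => h.hmeas _)
  have := h.hgauss n ts (fun i => L (Pi.single i 1)) hts
  refine ⟨_, _, Eq.trans ?_ this⟩
  rw [Measure.map_map L.continuous.measurable hm]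
  congr 1
  ext ω
  simp only [Function.comp]
  conv_lhs => rw [← Finset.univ_sum_single (fun i => B (ts i) ω), map_sum]
  refine Finset.sum_congr rfl fun i _ => ?_
  have : (Pi.single i (B (ts i) ω) : Fin n → ℝ) = (B (ts i) ω) • Pi.single i 1 := by
    rw [← Pi.single_smul]; simp
  rw [this, map_smul, smul_eq_mul, mul_comm]

lemma IsBB.law1 (h : IsBB P t0 t1 a b B) {t : ℝ} (ht : t ∈ Set.Icc t0 t1) :
    P.map (B t) = gaussianReal (a + (t - t0) / (t1 - t0) * (b - a))
      (Real.toNNReal ((t - t0) * (t1 - t) / (t1 - t0))) := by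
  simpa using h.hgauss 1 (fun _ => t) (fun _ => 1) (fun _ => ht)

lemma IsBB.memLp (h : IsBB P t0 t1 a b B) {t : ℝ} (ht : t ∈ Set.Icc t0 t1) :
    MemLp (B t) 2 P := by
  have : MemLp id 2 (P.map (B t)) := by
    rw [h.law1 ht]; exact memLp_id_gaussianReal 2
  exact (memLp_map_measure_iff (by fun_prop) (h.hmeas t).aemeasurable).1 this

lemma IsBB.var (h : IsBB P t0 t1 a b B) {t : ℝ} (ht : t ∈ Set.Icc t0 t1) :
    Var[B t; P] = (t - t0) * (t1 - t) / (t1 - t0) := by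
  rw [← variance_id_map (h.hmeas t).aemeasurable, h.law1 ht, variance_id_gaussianReal]
  refine Real.coe_toNNReal _ ?_
  have := h.ht
  exact div_nonneg (mul_nonneg (by linarith [ht.1]) (by linarith [ht.2])) (by linarith)

lemma IsBB.cov (h : IsBB P t0 t1 a b B) {s t : ℝ} (hs : s ∈ Set.Icc t0 t1)
    (ht : t ∈ Set.Icc t0 t1) (hst : s ≤ t) :
    cov[B s, B t; P] = (s - t0) * (t1 - t) / (t1 - t0) := by
  have h1 := variance_add (h.memLp hs) (h.memLp ht)
  have h2 : Var[B s + B t; P] = (s - t0) * (t1 - s) / (t1 - t0)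
      + 2 * ((s - t0) * (t1 - t) / (t1 - t0)) + (t - t0) * (t1 - t) / (t1 - t0) := by
    have h3 := h.hgauss 2 ![s, t] ![1, 1] (by intro i; fin_cases i <;> simpa)
    simp only [Fin.sum_univ_two, Matrix.cons_val_zero, Matrix.cons_val_one, one_mul,
      min_self, max_self, min_eq_left hst, max_eq_right hst, min_eq_right hst,
      max_eq_left hst] at h3
    have h4 : P.map (B s + B t) = _ := h3
    rw [← variance_id_map ((h.hmeas s).add (h.hmeas t)).aemeasurable, h4,
      variance_id_gaussianReal, Real.coe_toNNReal]
    · ring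
    · have := h.ht
      have a1 : 0 ≤ s - t0 := by linarith [hs.1]
      have a2 : 0 ≤ t - t0 := by linarith [ht.1]
      have a3 : 0 ≤ t1 - s := by linarith [hs.2]
      have a4 : 0 ≤ t1 - t := by linarith [ht.2]
      have a5 : 0 ≤ t1 - t0 := by linarith
      positivity
  rw [h2, h.var hs, h.var ht] at h1
  linarith

lemma IsBB.indep (h : IsBB P t0 t1 a b B) (n : ℕ) (ts : Fin n → ℝ) {s t : ℝ}
    (hts : ∀ i, ts i ∈ Set.Icc t0 t) (ht0 : t0 ≤ t) (hst : t ≤ s) (hs : s < t1) :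
    IndepFun (fun ω (i : Fin n) => B (ts i) ω)
      (fun ω => B s ω / (t1 - s) - B t ω / (t1 - t)) P := by
  let us : Fin (n + 2) → ℝ := Fin.cons s (Fin.cons t ts)
  have hus : ∀ i, us i ∈ Set.Icc t0 t1 := by
    intro i
    refine Fin.cases ?_ (fun i => Fin.cases ?_ (fun i => ?_) i) i
    · exact ⟨by simp [us]; linarith, by simp [us]; linarith⟩
    · exact ⟨by simpa [us], by simp [us]; linarith⟩
    · exact ⟨by simpa [us] using (hts i).1, by simp [us]; linarith [(hts i).2]⟩
  have hV := h.gauss_vec (n + 2) us hus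
  let L : (Fin (n + 2) → ℝ) →L[ℝ] ((Fin n → ℝ) × (Unit → ℝ)) :=
    LinearMap.toContinuousLinearMap
    { toFun := fun x => (fun i => x i.succ.succ,
        fun _ => x 0 / (t1 - s) - x (Fin.succ 0) / (t1 - t))
      map_add' := fun x y => by
        refine Prod.ext (by ext; simp) ?_
        ext; simp only [Pi.add_apply, Prod.snd_add]; ring
      map_smul' := fun c x => by
        refine Prod.ext (by ext; simp) ?_
        ext; simp only [Pi.smul_apply, Prod.smul_snd, smul_eq_mul, RingHom.id_apply]; ring }
  have hL := hV.map L
  have hI := HasGaussianLaw.indepFun_of_covariance_eval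
    (X := fun i ω => B (ts i) ω)
    (Y := fun (_ : Unit) ω => B s ω / (t1 - s) - B t ω / (t1 - t)) (P := P) (by
      exact hL) (by
    intro i _
    have hsI : s ∈ Set.Icc t0 t1 := ⟨by linarith, by linarith⟩
    have htI : t ∈ Set.Icc t0 t1 := ⟨by linarith, by linarith⟩
    have hiI : ts i ∈ Set.Icc t0 t1 := ⟨(hts i).1, by linarith [(hts i).2]⟩
    have e1 : (fun ω => B s ω / (t1 - s) - B t ω / (t1 - t))
        = (fun ω => (t1 - s)⁻¹ * B s ω) - (fun ω => (t1 - t)⁻¹ * B t ω) := by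
      ext ω; simp only [Pi.sub_apply]; ring
    rw [e1, covariance_sub_right (h.memLp hiI) ((h.memLp hsI).const_mul _)
      ((h.memLp htI).const_mul _), covariance_const_mul_right, covariance_const_mul_right,
      h.cov hiI hsI ((hts i).2.trans hst), h.cov hiI htI (hts i).2]
    have h1 : t1 - s ≠ 0 := by linarith
    have h2 : t1 - t ≠ 0 := by linarith
    have h3 : t1 - t0 ≠ 0 := by linarith
    field_simp
    ring)
  exact hI.comp (φ := id) (ψ := fun z : Unit → ℝ => z ()) measurable_id (measurable_pi_apply _)

/-- the exponential martingale -/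
noncomputable def mart (t1 b y : ℝ) (B : ℝ → Ω → ℝ) (t : ℝ) (ω : Ω) : ℝ≥0∞ :=
  ENNReal.ofReal (rexp (-2 * (b - y) * ((B t ω - y) / (t1 - t))))

lemma IsBB.mart_meas (h : IsBB P t0 t1 a b B) (y t : ℝ) : Measurable (mart t1 b y B t) := by
  have := h.hmeas t
  unfold mart
  fun_prop

lemma IsBB.lintegral_exp (h : IsBB P t0 t1 a b B) (u c : ℝ) {t : ℝ} (ht : t ∈ Set.Icc t0 t1) :
    ∫⁻ ω, ENNReal.ofReal (rexp (u * B t ω + c)) ∂P = ENNReal.ofReal (rexp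
      ((a + (t - t0) / (t1 - t0) * (b - a)) * u + ((t - t0) * (t1 - t) / (t1 - t0)) * u ^ 2 / 2
        + c)) := by
  have hint : Integrable (fun ω => rexp (u * B t ω)) P := by
    have := integrable_exp_mul_gaussianReal (μ := (a + (t - t0) / (t1 - t0) * (b - a)))
      (v := (Real.toNNReal ((t - t0) * (t1 - t) / (t1 - t0)))) u
    rw [← h.law1 ht] at this
    exact this.comp_measurable (h.hmeas t)
  have hm := mgf_gaussianReal (h.law1 ht) u
  rw [Real.coe_toNNReal] at hm
  · simp_rw [Real.exp_add _ c]
    rw [← ofReal_integral_eq_lintegral_ofReal (hint.mul_const _) (ae_of_all _ fun ω => by positivity),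
      integral_mul_const]
    rw [mgf] at hm
    rw [hm]
  · have := h.ht
    exact div_nonneg (mul_nonneg (by linarith [ht.1]) (by linarith [ht.2])) (by linarith)

lemma IsBB.lintegral_mart (h : IsBB P t0 t1 a b B) (y : ℝ) {t : ℝ} (ht : t ∈ Set.Ico t0 t1) :
    ∫⁻ ω, mart t1 b y B t ω ∂P = ENNReal.ofReal (rexp (-2 * (a - y) * (b - y) / (t1 - t0))) := by
  have h1 : t1 - t ≠ 0 := by linarith [ht.2]
  have h3 : t1 - t0 ≠ 0 := by linarith [h.ht]
  have := h.lintegral_exp (-2 * (b - y) / (t1 - t)) (2 * (b - y) * y / (t1 - t))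
    ⟨ht.1, ht.2.le⟩
  convert this using 3
  · unfold mart
    congr 2
    ring
  · field_simp
    ring

lemma IsBB.lintegral_mart_sq (h : IsBB P t0 t1 a b B) (y : ℝ) {t : ℝ} (ht : t ∈ Set.Icc t0 t1) :
    ∫⁻ ω, mart t1 b y B t ω ^ 2 ∂P ≠ ∞ := by
  have := h.lintegral_exp (-4 * (b - y) / (t1 - t)) (4 * (b - y) * y / (t1 - t)) ht
  have e : ∀ ω, mart t1 b y B t ω ^ 2 = ENNReal.ofReal (rexp
      (-4 * (b - y) / (t1 - t) * B t ω + 4 * (b - y) * y / (t1 - t))) := by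
    intro ω
    unfold mart
    rw [← ENNReal.ofReal_pow (by positivity), ← Real.exp_nat_mul]
    congr 2
    push_cast
    ring
  simp_rw [e]
  rw [this]
  exact ENNReal.ofReal_ne_top

/-- martingale identities against functions of the past -/
lemma IsBB.mart_past (h : IsBB P t0 t1 a b B) (y : ℝ) (n : ℕ) (ts : Fin n → ℝ) {s t : ℝ}
    (hts : ∀ i, ts i ∈ Set.Icc t0 t) (ht0 : t0 ≤ t) (hst : t ≤ s) (hs : s < t1)
    (i0 : Fin n) (hi0 : ts i0 = t)
    (S : Set (Fin n → ℝ)) (hS : MeasurableSet S) (A : Set Ω)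
    (hA : A = (fun ω (i : Fin n) => B (ts i) ω) ⁻¹' S) :
    (∫⁻ ω in A, mart t1 b y B t ω ∂P = ∫⁻ ω in A, mart t1 b y B s ω ∂P) ∧
    (∫⁻ ω in A, mart t1 b y B t ω ^ 2 ∂P ≤ ∫⁻ ω in A, mart t1 b y B s ω ^ 2 ∂P) := by
  have hm : Measurable (fun ω (i : Fin n) => B (ts i) ω) :=
    measurable_pi_lambda _ (fun i => h.hmeas _)
  have hAm : MeasurableSet A := hA ▸ hm hS
  have hI := h.indep n ts hts ht0 hst hs
  let r : ℝ → ℝ≥0∞ := fun d => ENNReal.ofReal (rexp (-2 * (b - y) *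
    (d - y * ((t1 - s)⁻¹ - (t1 - t)⁻¹))))
  let D : Ω → ℝ := fun ω => B s ω / (t1 - s) - B t ω / (t1 - t)
  have hr : Measurable r := by fun_prop
  have hDm : Measurable D := ((h.hmeas s).div_const _).sub ((h.hmeas t).div_const _)
  have hfac : ∀ ω, mart t1 b y B s ω = mart t1 b y B t ω * r (D ω) := by
    intro ω
    simp only [mart, r, D]
    rw [← ENNReal.ofReal_mul (by positivity), ← Real.exp_add]
    congr 2
    ring
  let g : (Fin n → ℝ) → ℝ≥0∞ := fun x =>
    ENNReal.ofReal (rexp (-2 * (b - y) * ((x i0 - y) / (t1 - t))))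
  have hg : Measurable g := by fun_prop
  have hgt : ∀ ω, mart t1 b y B t ω = g (fun i => B (ts i) ω) := by
    intro ω; simp only [mart, g, hi0]
  -- product formula
  have key : ∀ (q : ℕ) (T : Set (Fin n → ℝ)) (hT : MeasurableSet T),
      ∫⁻ ω in (fun ω (i : Fin n) => B (ts i) ω) ⁻¹' T, mart t1 b y B s ω ^ q ∂P
       = (∫⁻ ω in (fun ω (i : Fin n) => B (ts i) ω) ⁻¹' T, mart t1 b y B t ω ^ q ∂P) *
        ∫⁻ ω, r (D ω) ^ q ∂P := by
    intro q T hT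
    rw [← lintegral_indicator (hm hT), ← lintegral_indicator (hm hT)]
    have hgq : Measurable (T.indicator (fun x => g x ^ q)) := (hg.pow_const q).indicator hT
    have := lintegral_mul_eq_lintegral_mul_lintegral_of_indepFun
      (f := fun ω => T.indicator (fun x => g x ^ q) (fun i => B (ts i) ω))
      (g := fun ω => r (D ω) ^ q) (μ := P) (hgq.comp hm) ((hr.pow_const q).comp hDm)
      (hI.comp (φ := T.indicator (fun x => g x ^ q)) (ψ := fun d => r d ^ q) hgq
        (hr.pow_const q))
    convert this using 2
    · ext ω
      rw [Pi.mul_apply]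
      by_cases hω : (fun i => B (ts i) ω) ∈ T
      · rw [Set.indicator_of_mem (show ω ∈ (fun ω (i : Fin n) => B (ts i) ω) ⁻¹' T from hω),
          Set.indicator_of_mem hω, hfac, hgt, mul_pow]
      · rw [Set.indicator_of_notMem (show ω ∉ (fun ω (i : Fin n) => B (ts i) ω) ⁻¹' T from hω),
          Set.indicator_of_notMem hω, zero_mul]
    · congr 1
      ext ω
      by_cases hω : (fun i => B (ts i) ω) ∈ T
      · rw [Set.indicator_of_mem (show ω ∈ (fun ω (i : Fin n) => B (ts i) ω) ⁻¹' T from hω),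
          Set.indicator_of_mem hω, hgt]
      · rw [Set.indicator_of_notMem (show ω ∉ (fun ω (i : Fin n) => B (ts i) ω) ⁻¹' T from hω),
          Set.indicator_of_notMem hω]
  have hone : ∫⁻ ω, r (D ω) ∂P = 1 := by
    have := key 1 Set.univ MeasurableSet.univ
    simp only [pow_one, Set.preimage_univ, Measure.restrict_univ] at this
    rw [h.lintegral_mart y ⟨by linarith, hs⟩, h.lintegral_mart y ⟨ht0, by linarith⟩] at this
    have hne : ENNReal.ofReal (rexp (-2 * (a - y) * (b - y) / (t1 - t0))) ≠ 0 := by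
      simp [Real.exp_pos]
    exact (ENNReal.mul_eq_left hne ENNReal.ofReal_ne_top).1 this.symm
  have hsq : 1 ≤ ∫⁻ ω, r (D ω) ^ 2 ∂P := by
    have h2 : ∫⁻ ω, 2 * r (D ω) ∂P ≤ ∫⁻ ω, (r (D ω) ^ 2 + 1) ∂P := by
      refine lintegral_mono fun ω => ?_
      simp only [r]
      rw [← ENNReal.ofReal_pow (by positivity), ← ENNReal.ofReal_one,
        ← ENNReal.ofReal_add (by positivity) (by positivity), ← ENNReal.ofReal_ofNat,
        ← ENNReal.ofReal_mul (by positivity)]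
      refine ENNReal.ofReal_le_ofReal ?_
      nlinarith [sq_nonneg (rexp (-2 * (b - y) * (D ω - y * ((t1 - s)⁻¹ - (t1 - t)⁻¹))) - 1)]
    rw [lintegral_const_mul (μ := P) 2 (show Measurable (fun ω => r (D ω)) from hr.comp hDm), hone,
      lintegral_add_right _ measurable_const] at h2
    simp only [mul_one, lintegral_const, measure_univ] at h2
    rw [← one_add_one_eq_two] at h2
    exact (ENNReal.add_le_add_iff_right ENNReal.one_ne_top).1 h2
  subst hA
  refine ⟨?_, ?_⟩
  · have := key 1 S hS
    simp only [pow_one] at this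
    rw [this, hone, mul_one]
  · rw [key 2 S hS]
    exact le_mul_of_one_le_right zero_le hsq


lemma IsBB.grid (h : IsBB P t0 t1 a b B) (y : ℝ) (τ : ℕ → ℝ) (hτ : Monotone τ)
    (h0 : t0 ≤ τ 0) (N : ℕ) (hN : τ N < t1) (k : ℕ) (hk : k ≤ N) :
    (∫⁻ ω in fstHit (fun j => mart t1 b y B (τ j)) k, mart t1 b y B (τ k) ω ∂P
      = ∫⁻ ω in fstHit (fun j => mart t1 b y B (τ j)) k, mart t1 b y B (τ N) ω ∂P) ∧
    (∫⁻ ω in fstHit (fun j => mart t1 b y B (τ j)) k, mart t1 b y B (τ k) ω ^ 2 ∂P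
      ≤ ∫⁻ ω in fstHit (fun j => mart t1 b y B (τ j)) k, mart t1 b y B (τ N) ω ^ 2 ∂P) := by
  let φ : ℝ → ℝ → ℝ≥0∞ := fun t x => ENNReal.ofReal (rexp (-2 * (b - y) * ((x - y) / (t1 - t))))
  have hφ : ∀ t, Measurable (φ t) := fun t => by fun_prop
  let S : Set (Fin (k+1) → ℝ) :=
    (⋂ j : Fin k, {x | φ (τ j) (x j.castSucc) < 1}) ∩ {x | 1 ≤ φ (τ k) (x (Fin.last k))}
  refine h.mart_past y (k+1) (fun i => τ i) (s := τ N) (t := τ k) ?_ ?_ (hτ hk) hN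
    (Fin.last k) (by simp) S ?_ _ ?_
  · intro i
    exact ⟨h0.trans (hτ (Nat.zero_le _)), hτ (by omega)⟩
  · exact h0.trans (hτ (Nat.zero_le _))
  · refine MeasurableSet.inter (MeasurableSet.iInter fun j => ?_) ?_
    · exact measurableSet_lt ((hφ _).comp (measurable_pi_apply _)) measurable_const
    · exact measurableSet_le measurable_const ((hφ _).comp (measurable_pi_apply _))
  · ext ω
    simp only [fstHit, S, Set.mem_ofPred_eq, Set.mem_preimage, Set.mem_inter_iff, Set.mem_iInter,
      Fin.val_castSucc, Fin.val_last]
    exact and_congr ⟨fun H j => H j j.2, fun H j hj => H ⟨j, hj⟩⟩ Iff.rfl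

lemma IsBB.start (h : IsBB P t0 t1 a b B) : ∀ᵐ ω ∂P, B t0 ω = a := by
  have := h.law1 (t := t0) ⟨le_rfl, h.ht.le⟩
  simp at this
  refine ae_of_ae_map (p := fun x => x = a) (h.hmeas t0).aemeasurable ?_
  rw [this]
  simp [ae_dirac_eq]

lemma IsBB.finish_val (h : IsBB P t0 t1 a b B) : ∀ᵐ ω ∂P, B t1 ω = b := by
  have := h.law1 (t := t1) ⟨h.ht.le, le_rfl⟩
  have h3 : t1 - t0 ≠ 0 := by linarith [h.ht]
  simp [div_self h3] at this
  refine ae_of_ae_map (p := fun x => x = b) (h.hmeas t1).aemeasurable ?_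
  rw [this]
  simp [ae_dirac_eq]

lemma one_le_mart {y t : ℝ} (hy : y < b) (ht : t < t1) (ω : Ω) :
    1 ≤ mart t1 b y B t ω ↔ B t ω ≤ y := by
  unfold mart
  rw [ENNReal.one_le_ofReal, Real.one_le_exp_iff]
  have h1 : 0 < t1 - t := by linarith
  have h2 : 0 < b - y := by linarith
  constructor
  · intro H
    by_contra hc
    have : 0 < (B t ω - y) / (t1 - t) := div_pos (by linarith) h1
    nlinarith
  · intro H
    have : (B t ω - y) / (t1 - t) ≤ 0 := div_nonpos_of_nonpos_of_nonneg (by linarith) h1.le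
    nlinarith

lemma IsBB.upper (h : IsBB P t0 t1 a b B) {y : ℝ} (hy : y < b) :
    P {ω | ∃ t ∈ Set.Ico t0 t1, B t ω < y} ≤
      ENNReal.ofReal (rexp (-2 * (a - y) * (b - y) / (t1 - t0))) := by
  have hT : 0 < t1 - t0 := by linarith [h.ht]
  let τ : ℕ → ℕ → ℝ := fun N k => t0 + (t1 - t0) * k / (N + 1)
  have hτm : ∀ N, Monotone (τ N) := by
    intro N i j hij
    have : (i : ℝ) ≤ j := by exact_mod_cast hij
    simp only [τ]
    gcongr
  have hτ1 : ∀ N, ∀ k ≤ N, τ N k < t1 := by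
    intro N k hk
    have hk' : (k : ℝ) < N + 1 := by exact_mod_cast Nat.lt_succ_of_le hk
    have : (t1 - t0) * k / (N + 1) < t1 - t0 := by
      rw [div_lt_iff₀ (by positivity)]
      gcongr
    simp only [τ]; linarith
  let E : ℕ → Set Ω := fun N => {ω | ∃ k ≤ N, 1 ≤ mart t1 b y B (τ N k) ω}
  have hE : ∀ N, P (E N) ≤ ENNReal.ofReal (rexp (-2 * (a - y) * (b - y) / (t1 - t0))) := by
    intro N
    have h0 : t0 ≤ τ N 0 := by simp [τ]
    have := discrete_upper P (fun j => mart t1 b y B (τ N j)) (fun k => h.mart_meas y _) N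
      (fun k hk => (h.grid y (τ N) (hτm N) h0 N (hτ1 N N le_rfl) k hk).1)
    rwa [h.lintegral_mart y ⟨h0.trans (hτm N (Nat.zero_le _)), hτ1 N N le_rfl⟩] at this
  let F : ℕ → Set Ω := fun n => ⋂ N ≥ n, E N
  have hF : Monotone F := by
    intro i j hij ω hω
    simp only [F, Set.mem_iInter] at hω ⊢
    exact fun N hN => hω N (hij.trans hN)
  calc P {ω | ∃ t ∈ Set.Ico t0 t1, B t ω < y} ≤ P (⋃ n, F n) := by
        refine measure_mono_ae ?_
        filter_upwards [h.hcont] with ω hω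
        rintro ⟨t, ht, hlt⟩
        have hcw := hω t ⟨ht.1, ht.2.le⟩
        have hev := hcw.eventually (gt_mem_nhds hlt)
        obtain ⟨δ, hδ, hball⟩ := Metric.mem_nhdsWithin_iff.1 hev
        obtain ⟨n, hn⟩ := exists_nat_gt ((t1 - t0) / δ)
        refine Set.mem_iUnion.2 ⟨n, Set.mem_iInter₂.2 fun N hN => ?_⟩
        have hNp : (0 : ℝ) < N + 1 := by positivity
        have hNδ : (t1 - t0) / (N + 1) < δ := by
          rw [div_lt_iff₀ hδ] at hn
          rw [div_lt_iff₀ hNp]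
          have : (n : ℝ) ≤ N := by exact_mod_cast hN
          nlinarith
        let x : ℝ := (t - t0) * (N + 1) / (t1 - t0)
        have hx0 : 0 ≤ x := by
          have : 0 ≤ t - t0 := by linarith [ht.1]
          positivity
        have hxN : x < N + 1 := by
          simp only [x]
          rw [div_lt_iff₀ hT]
          nlinarith [ht.2]
        have hk1 : (⌊x⌋₊ : ℝ) ≤ x := Nat.floor_le hx0
        have hk2 : x < ⌊x⌋₊ + 1 := Nat.lt_floor_add_one x
        have hkN : ⌊x⌋₊ ≤ N := by
          have : ⌊x⌋₊ < N + 1 := by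
            rw [Nat.floor_lt hx0]; exact_mod_cast hxN
          omega
        have htx : t = t0 + (t1 - t0) * x / (N + 1) := by
          simp only [x]; field_simp; ring
        refine ⟨⌊x⌋₊, hkN, (one_le_mart hy (hτ1 N _ hkN) ω).2 ?_⟩
        have hmem : τ N ⌊x⌋₊ ∈ Metric.ball t δ ∩ Set.Icc t0 t1 := by
          refine ⟨?_, ?_, (hτ1 N _ hkN).le⟩
          · have e : τ N ⌊x⌋₊ - t = (t1 - t0) / (N + 1) * (⌊x⌋₊ - x) := by
              rw [htx]; simp only [τ]
              ring
            have hd : 0 < (t1 - t0) / (N + 1) := by positivity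
            rw [Metric.mem_ball, Real.dist_eq, e, abs_lt]
            constructor <;> nlinarith
          · simp only [τ]
            have : 0 ≤ (t1 - t0) * (⌊x⌋₊ : ℝ) / (N + 1) := by positivity
            linarith
        have := hball hmem
        exact le_of_lt this
    _ = ⨆ n, P (F n) := hF.measure_iUnion
    _ ≤ _ := iSup_le fun n => (measure_mono (Set.iInter₂_subset n le_rfl)).trans (hE n)

lemma IsBB.lower_aux (h : IsBB P t0 t1 a b B) {y : ℝ} (hya : y < a) (hyb : y < b) {s : ℝ}
    (hs0 : t0 < s) (hs1 : s < t1) (n : ℕ) :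
    ENNReal.ofReal (rexp (-2 * (a - y) * (b - y) / (t1 - t0))) ≤
      (1 + (n + 1 : ℝ≥0∞)⁻¹) * P {ω | ∃ t ∈ Set.Icc t0 t1, B t ω ≤ y}
      + (n + 1 : ℝ≥0∞)⁻¹ * ∫⁻ ω, mart t1 b y B s ω ^ 2 ∂P
      + ∫⁻ ω, min (mart t1 b y B s ω) 1 ∂P := by
  let τ : ℕ → ℕ → ℝ := fun N k => t0 + (s - t0) * k / (N + 1)
  have hτm : ∀ N, Monotone (τ N) := by
    intro N i j hij
    have : (i : ℝ) ≤ j := by exact_mod_cast hij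
    have : 0 < s - t0 := by linarith
    simp only [τ]
    gcongr
  have hτs : ∀ N, τ N (N + 1) = s := by
    intro N
    have : (N + 1 : ℝ) ≠ 0 := by positivity
    simp only [τ]; push_cast; field_simp; ring
  have hτ0 : ∀ N, τ N 0 = t0 := by simp [τ]
  have hK0 : (n + 1 : ℝ≥0∞) ≠ 0 := by simp
  have hK : (n + 1 : ℝ≥0∞) ≠ ∞ := by finiteness
  let ε : ℝ := ((n : ℝ) + 1)⁻¹
  have hε0 : 0 < ε := by positivity
  have hε : (n + 1 : ℝ≥0∞)⁻¹ = ENNReal.ofReal ε := by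
    simp only [ε]
    rw [ENNReal.ofReal_inv_of_pos (by positivity), ENNReal.ofReal_add (by positivity) zero_le_one]
    simp
  let G : ℕ → Set Ω := fun N => {ω | ∃ k ≤ N + 1,
    ω ∈ fstHit (fun j => mart t1 b y B (τ N j)) k ∧ 1 + (n + 1 : ℝ≥0∞)⁻¹ < mart t1 b y B (τ N k) ω}
  have hGm : ∀ N, MeasurableSet (G N) := by
    intro N
    have : G N = ⋃ k ∈ Finset.range (N+1+1), fstHit (fun j => mart t1 b y B (τ N j)) k ∩
        {ω | 1 + (n + 1 : ℝ≥0∞)⁻¹ < mart t1 b y B (τ N k) ω} := by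
      ext ω
      simp only [G, Finset.mem_range, Set.mem_iUnion, Set.mem_inter_iff, Set.mem_ofPred_eq,
        exists_prop, Nat.lt_succ_iff]
    rw [this]
    exact Finset.measurableSet_biUnion _
      (fun k _ => (fstHit_meas _ (fun k => h.mart_meas y _) k).inter
        (measurableSet_lt measurable_const (h.mart_meas y _)))
  have hmain : ∀ N, ENNReal.ofReal (rexp (-2 * (a - y) * (b - y) / (t1 - t0))) ≤
      (1 + (n + 1 : ℝ≥0∞)⁻¹) * P {ω | ∃ t ∈ Set.Icc t0 t1, B t ω ≤ y}
      + (n + 1 : ℝ≥0∞) * P (G N)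
      + (n + 1 : ℝ≥0∞)⁻¹ * ∫⁻ ω, mart t1 b y B s ω ^ 2 ∂P
      + ∫⁻ ω, min (mart t1 b y B s ω) 1 ∂P := by
    intro N
    have hg := h.grid y (τ N) (hτm N) (hτ0 N).ge (N+1) (by rw [hτs]; exact hs1)
    have := discrete_lower P (fun j => mart t1 b y B (τ N j)) (fun k => h.mart_meas y _) (N+1)
      (fun k hk => (hg k hk).1) (fun k hk => (hg k hk).2) (n + 1 : ℝ≥0∞)⁻¹ _ hK0 hK
    simp only [hτs] at this
    rw [h.lintegral_mart y ⟨hs0.le, hs1⟩] at this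
    refine this.trans ?_
    have hsub : P {ω | ∃ k ≤ N + 1, 1 ≤ mart t1 b y B (τ N k) ω} ≤
        P {ω | ∃ t ∈ Set.Icc t0 t1, B t ω ≤ y} := by
      refine measure_mono ?_
      rintro ω ⟨k, hk, hk1⟩
      have hks : τ N k ≤ s := by rw [← hτs N]; exact hτm N hk
      refine ⟨τ N k, ⟨?_, by linarith⟩, (one_le_mart hyb (by linarith) ω).1 hk1⟩
      rw [← hτ0 N]; exact hτm N (Nat.zero_le _)
    gcongr
  have hGlim : Filter.Tendsto (fun N => P (G N)) Filter.atTop (nhds 0) := by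
    have := tendsto_measure_of_ae_tendsto_indicator_of_isFiniteMeasure (μ := P)
      (As := G) (A := ∅) Filter.atTop MeasurableSet.empty hGm (by
      filter_upwards [h.hcont, h.start] with ω hω hωa
      let f : ℝ → ℝ := fun t => rexp (-2 * (b - y) * ((B t ω - y) / (t1 - t)))
      have hfc : ContinuousOn f (Set.Icc t0 s) := by
        have h1 : ContinuousOn (fun t => B t ω) (Set.Icc t0 s) :=
          hω.mono (Set.Icc_subset_Icc le_rfl hs1.le)
        refine Real.continuous_exp.comp_continuousOn (continuousOn_const.mul
          ((h1.sub continuousOn_const).div (by fun_prop) ?_))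
        intro t ht
        linarith [ht.2]
      have huc := isCompact_Icc.uniformContinuousOn_of_continuous hfc
      obtain ⟨δ, hδ, hd⟩ := Metric.uniformContinuousOn_iff.1 huc ε hε0
      obtain ⟨m, hm⟩ := exists_nat_gt ((s - t0) / δ)
      filter_upwards [Filter.eventually_ge_atTop m] with N hN
      simp only [Set.mem_empty_iff_false, iff_false]
      rintro ⟨k, hk, ⟨hk1, hk2⟩, hk3⟩
      rcases k with _ | k
      · rw [one_le_mart hyb (by rw [hτ0]; linarith), hτ0, hωa] at hk2
        linarith
      · have hlt := hk1 k (Nat.lt_succ_self k)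
        have hin : ∀ j ≤ N + 1, τ N j ∈ Set.Icc t0 s := by
          intro j hj
          refine ⟨?_, ?_⟩
          · rw [← hτ0 N]; exact hτm N (Nat.zero_le _)
          · rw [← hτs N]; exact hτm N hj
        have hNp : (0 : ℝ) < N + 1 := by positivity
        have hdist : dist (τ N (k+1)) (τ N k) < δ := by
          have e : τ N (k+1) - τ N k = (s - t0) / (N + 1) := by
            simp only [τ]; push_cast; ring
          rw [Real.dist_eq, e, abs_of_nonneg (div_nonneg (by linarith) hNp.le), div_lt_iff₀ hNp]
          rw [div_lt_iff₀ hδ] at hm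
          have : (m : ℝ) ≤ N := by exact_mod_cast hN
          nlinarith
        have hf := hd _ (hin (k+1) hk) _ (hin k (by omega)) hdist
        have hf1 : f (τ N k) < 1 := by
          have : ENNReal.ofReal (f (τ N k)) < 1 := hlt
          rwa [ENNReal.ofReal_lt_one] at this
        have hf2 : 1 + ε < f (τ N (k+1)) := by
          rw [hε, ← ENNReal.ofReal_one, ← ENNReal.ofReal_add zero_le_one hε0.le] at hk3
          have : ENNReal.ofReal (1 + ε) < ENNReal.ofReal (f (τ N (k+1))) := hk3
          exact (ENNReal.ofReal_lt_ofReal_iff (Real.exp_pos _)).1 this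
        rw [Real.dist_eq, abs_lt] at hf
        linarith [hf.2])
    simpa using this
  have hlim := (((ENNReal.Tendsto.const_mul hGlim (Or.inr hK)).const_add
    ((1 + (n + 1 : ℝ≥0∞)⁻¹) * P {ω | ∃ t ∈ Set.Icc t0 t1, B t ω ≤ y})).add_const
    ((n + 1 : ℝ≥0∞)⁻¹ * ∫⁻ ω, mart t1 b y B s ω ^ 2 ∂P)).add_const
      (∫⁻ ω, min (mart t1 b y B s ω) 1 ∂P)
  have := ge_of_tendsto' hlim hmain
  simpa using this

lemma IsBB.lower_s (h : IsBB P t0 t1 a b B) {y : ℝ} (hya : y < a) (hyb : y < b) {s : ℝ}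
    (hs0 : t0 < s) (hs1 : s < t1) :
    ENNReal.ofReal (rexp (-2 * (a - y) * (b - y) / (t1 - t0))) ≤
      P {ω | ∃ t ∈ Set.Icc t0 t1, B t ω ≤ y} + ∫⁻ ω, min (mart t1 b y B s ω) 1 ∂P := by
  have hinv : Filter.Tendsto (fun n : ℕ => (n + 1 : ℝ≥0∞)⁻¹) Filter.atTop (nhds 0) := by
    have := (Filter.tendsto_add_atTop_iff_nat 1).2 ENNReal.tendsto_inv_nat_nhds_zero
    simpa using this
  have hlim := ((ENNReal.Tendsto.mul_const (hinv.const_add 1)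
      (b := P {ω | ∃ t ∈ Set.Icc t0 t1, B t ω ≤ y}) (Or.inr (measure_ne_top _ _))).add
    (ENNReal.Tendsto.mul_const hinv (b := ∫⁻ ω, mart t1 b y B s ω ^ 2 ∂P)
      (Or.inr (h.lintegral_mart_sq y ⟨hs0.le, hs1.le⟩)))).add_const
      (∫⁻ ω, min (mart t1 b y B s ω) 1 ∂P)
  have := ge_of_tendsto' hlim (h.lower_aux hya hyb hs0 hs1)
  simpa using this

lemma IsBB.lower (h : IsBB P t0 t1 a b B) {y : ℝ} (hya : y < a) (hyb : y < b) :
    ENNReal.ofReal (rexp (-2 * (a - y) * (b - y) / (t1 - t0))) ≤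
      P {ω | ∃ t ∈ Set.Icc t0 t1, B t ω ≤ y} := by
  obtain ⟨u, -, hu, hul⟩ := exists_seq_strictMono_tendsto' h.ht
  have hlim : Filter.Tendsto (fun n => ∫⁻ ω, min (mart t1 b y B (u n) ω) 1 ∂P)
      Filter.atTop (nhds (∫⁻ _, 0 ∂P)) := by
    refine tendsto_lintegral_of_dominated_convergence (fun _ => 1)
      (fun n => (h.mart_meas y _).min measurable_const)
      (fun n => ae_of_all _ fun ω => min_le_right _ _) (by simp) ?_
    filter_upwards [h.hcont, h.finish_val] with ω hω hωb
    have hB : Filter.Tendsto (fun n => B (u n) ω) Filter.atTop (nhds b) := by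
      have := hω t1 ⟨h.ht.le, le_rfl⟩
      rw [ContinuousWithinAt, hωb] at this
      exact this.comp (tendsto_nhdsWithin_iff.2
        ⟨hul, Filter.Eventually.of_forall fun n => ⟨(hu n).1.le, (hu n).2.le⟩⟩)
    have hden : Filter.Tendsto (fun n => (t1 - u n)⁻¹) Filter.atTop Filter.atTop := by
      refine Filter.Tendsto.inv_tendsto_nhdsGT_zero ?_
      refine tendsto_nhdsWithin_iff.2 ⟨?_, Filter.Eventually.of_forall fun n => ?_⟩
      · simpa using hul.const_sub t1
      · have := (hu n).2
        simp only [Set.mem_Ioi]; linarith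
    have hq : Filter.Tendsto (fun n => (B (u n) ω - y) / (t1 - u n)) Filter.atTop Filter.atTop :=
      Filter.Tendsto.pos_mul_atTop (sub_pos.2 hyb) (hB.sub_const y) hden
    have he : Filter.Tendsto (fun n => mart t1 b y B (u n) ω) Filter.atTop (nhds 0) := by
      have hc : -2 * (b - y) < 0 := by linarith
      have := (Real.tendsto_exp_atBot.comp (hq.const_mul_atTop_of_neg hc))
      have := ENNReal.tendsto_ofReal this
      simpa [mart, Function.comp_def] using this
    have := he.min (tendsto_const_nhds (x := (1 : ℝ≥0∞)))
    simpa using this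
  have := ge_of_tendsto' (hlim.const_add (P {ω | ∃ t ∈ Set.Icc t0 t1, B t ω ≤ y}))
    (fun n => h.lower_s hya hyb (hu n).1 (hu n).2)
  simpa using this


lemma dens_tendsto (a b : ℝ) {T : ℝ} (hT : 0 < T) :
    Filter.Tendsto (fun y : ℝ => rexp (-2 * (a - y) * (b - y) / T)) Filter.atBot (nhds 0) := by
  refine Real.tendsto_exp_atBot.comp ?_
  have h1 : ∀ c : ℝ, Filter.Tendsto (fun y : ℝ => c - y) Filter.atBot Filter.atTop := by
    intro c
    simpa [sub_eq_add_neg] using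
      Filter.tendsto_atTop_add_const_left _ c Filter.tendsto_neg_atBot_atTop
  have h2 := ((h1 a).atTop_mul_atTop₀ (h1 b)).const_mul_atTop_of_neg
    (show (-2 / T : ℝ) < 0 from div_neg_of_neg_of_pos (by norm_num) hT)
  refine h2.congr fun y => ?_
  ring

lemma dens_deriv (a b : ℝ) {T : ℝ} (hT : 0 < T) (y : ℝ) :
    HasDerivAt (fun y : ℝ => rexp (-2 * (a - y) * (b - y) / T))
      (2 / T * (a + b - 2 * y) * rexp (-2 * (a - y) * (b - y) / T)) y := by
  have h1 : HasDerivAt (fun y : ℝ => -2 * (a - y) * (b - y) / T)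
      (2 / T * (a + b - 2 * y)) y := by
    have := ((((hasDerivAt_id y).const_sub a).const_mul (-2)).mul
      ((hasDerivAt_id y).const_sub b)).div_const T
    refine this.congr_deriv ?_
    simp
    ring
  refine h1.exp.congr_deriv ?_
  ring

lemma dens_cont (a b T : ℝ) : Continuous
    (fun y : ℝ => 2 / T * (a + b - 2 * y) * rexp (-2 * (a - y) * (b - y) / T)) := by
  fun_prop

lemma dens_integ (a b : ℝ) {T : ℝ} (hT : 0 < T) {x : ℝ} (hx : x ≤ min a b) :
    IntegrableOn (fun y : ℝ => 2 / T * (a + b - 2 * y) * rexp (-2 * (a - y) * (b - y) / T))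
      (Set.Iic x) := by
  refine integrableOn_Iic_of_intervalIntegral_norm_bounded
    (l := Filter.atBot) (a := fun i : ℝ => i) (rexp (-2 * (a - x) * (b - x) / T)) x ?_
    Filter.tendsto_id ?_
  · intro i
    exact ((dens_cont a b T).integrableOn_Icc).mono_set Set.Ioc_subset_Icc_self
  · filter_upwards [Filter.eventually_le_atBot x] with i hi
    have : ∫ y in i..x, ‖2 / T * (a + b - 2 * y) * rexp (-2 * (a - y) * (b - y) / T)‖
        = ∫ y in i..x, 2 / T * (a + b - 2 * y) * rexp (-2 * (a - y) * (b - y) / T) := by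
      refine intervalIntegral.integral_congr fun y hy => ?_
      rw [Set.uIcc_of_le hi] at hy
      have h1 := le_min_iff.1 (hy.2.trans hx)
      have h2 : 0 ≤ a + b - 2 * y := by linarith [h1.1, h1.2]
      rw [Real.norm_of_nonneg (by positivity)]
    rw [this, intervalIntegral.integral_eq_sub_of_hasDerivAt
      (fun y _ => dens_deriv a b hT y) ((dens_cont a b T).intervalIntegrable _ _)]
    linarith [Real.exp_pos (-2 * (a - i) * (b - i) / T)]

lemma dens_lintegral (a b : ℝ) {T : ℝ} (hT : 0 < T) {x : ℝ} (hx : x ≤ min a b) :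
    ∫⁻ y in Set.Iio x, ENNReal.ofReal (if y < min a b then
          2 / T * (a + b - 2 * y) * rexp (-2 * (a - y) * (b - y) / T) else 0)
      = ENNReal.ofReal (rexp (-2 * (a - x) * (b - x) / T)) := by
  have e1 : ∫⁻ y in Set.Iio x, ENNReal.ofReal (if y < min a b then
          2 / T * (a + b - 2 * y) * rexp (-2 * (a - y) * (b - y) / T) else 0)
      = ∫⁻ y in Set.Iio x, ENNReal.ofReal
          (2 / T * (a + b - 2 * y) * rexp (-2 * (a - y) * (b - y) / T)) := by
    refine setLIntegral_congr_fun measurableSet_Iio fun y hy => ?_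
    have : y < min a b := lt_of_lt_of_le hy hx
    simp only [if_pos this]
  rw [e1, setLIntegral_congr Iio_ae_eq_Iic, ← ofReal_integral_eq_lintegral_ofReal
    (dens_integ a b hT hx)]
  · rw [integral_Iic_of_hasDerivAt_of_tendsto' (fun y _ => dens_deriv a b hT y)
      (dens_integ a b hT hx) (dens_tendsto a b hT), sub_zero]
  · refine (ae_restrict_iff' measurableSet_Iic).2 (Filter.Eventually.of_forall fun y hy => ?_)
    have h1 := le_min_iff.1 (le_trans (Set.mem_Iic.1 hy) hx)
    have h2 : 0 ≤ a + b - 2 * y := by linarith [h1.1, h1.2]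
    simp only [Pi.zero_apply]
    positivity

lemma dens_Iic_lt (a b : ℝ) {T : ℝ} (hT : 0 < T) {x : ℝ} (hx : x ≤ min a b) :
    ∫⁻ y in Set.Iic x, ENNReal.ofReal (if y < min a b then
          2 / T * (a + b - 2 * y) * rexp (-2 * (a - y) * (b - y) / T) else 0)
      = ENNReal.ofReal (rexp (-2 * (a - x) * (b - x) / T)) := by
  rw [← dens_lintegral a b hT hx, setLIntegral_congr Iio_ae_eq_Iic]

lemma dens_Iic_ge (a b : ℝ) {T : ℝ} (hT : 0 < T) {x : ℝ} (hx : min a b ≤ x) :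
    ∫⁻ y in Set.Iic x, ENNReal.ofReal (if y < min a b then
          2 / T * (a + b - 2 * y) * rexp (-2 * (a - y) * (b - y) / T) else 0)
      = 1 := by
  have h0 := dens_Iic_lt a b hT (le_refl (min a b))
  have h1 : rexp (-2 * (a - min a b) * (b - min a b) / T) = 1 := by
    rcases min_choice a b with h | h <;> rw [h] <;> simp
  rw [h1, ENNReal.ofReal_one] at h0
  rw [← Set.Iic_union_Ioc_eq_Iic hx, lintegral_union measurableSet_Ioc, h0]
  · have : ∫⁻ y in Set.Ioc (min a b) x, ENNReal.ofReal (if y < min a b then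
          2 / T * (a + b - 2 * y) * rexp (-2 * (a - y) * (b - y) / T) else 0) = 0 := by
      rw [setLIntegral_congr_fun (g := fun _ => 0) measurableSet_Ioc]
      · simp
      · intro y hy
        have : ¬ y < min a b := not_lt.2 hy.1.le
        simp only [if_neg this, ENNReal.ofReal_zero]
    rw [this, add_zero]
  · exact Set.disjoint_left.2 fun y hy hy2 => absurd hy2.1 (not_lt.2 hy)

lemma sInf_le_iff_path {f : ℝ → ℝ} (ht : t0 < t1) (hf : ContinuousOn f (Set.Icc t0 t1)) (y : ℝ) :
    sInf (f '' Set.Icc t0 t1) ≤ y ↔ ∃ t ∈ Set.Icc t0 t1, f t ≤ y := by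
  have hne : (Set.Icc t0 t1).Nonempty := Set.nonempty_Icc.2 ht.le
  have hc := isCompact_Icc.image_of_continuousOn hf
  constructor
  · intro h
    obtain ⟨t, ht, hte⟩ := hc.sInf_mem (hne.image f)
    exact ⟨t, ht, hte.le.trans h⟩
  · rintro ⟨t, ht, hy⟩
    exact (csInf_le hc.bddBelow ⟨t, ht, rfl⟩).trans hy

lemma sInf_eq_path {f : ℝ → ℝ} (ht : t0 < t1) [Nonempty (Set.Icc t0 t1)]
    (hf : ContinuousOn f (Set.Icc t0 t1)) :
    sInf (f '' Set.Icc t0 t1)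
      = ⨅ n : ℕ, f (TopologicalSpace.denseSeq (Set.Icc t0 t1) n) := by
  have hne : (Set.Icc t0 t1).Nonempty := Set.nonempty_Icc.2 ht.le
  have hc := isCompact_Icc.image_of_continuousOn hf
  have hbdd : BddBelow (Set.range fun n : ℕ => f (TopologicalSpace.denseSeq (Set.Icc t0 t1) n)) := by
    refine hc.bddBelow.mono ?_
    rintro _ ⟨n, rfl⟩
    exact ⟨_, (TopologicalSpace.denseSeq (Set.Icc t0 t1) n).2, rfl⟩
  apply le_antisymm
  · refine le_ciInf fun n => csInf_le hc.bddBelow ⟨_, (TopologicalSpace.denseSeq (Set.Icc t0 t1) n).2, rfl⟩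
  · refine le_csInf (hne.image f) ?_
    rintro _ ⟨t, ht', rfl⟩
    have hcont : Continuous (fun s : Set.Icc t0 t1 => f s) := hf.domRestrict
    have hcl : IsClosed {s : Set.Icc t0 t1 |
        (⨅ n : ℕ, f (TopologicalSpace.denseSeq (Set.Icc t0 t1) n)) ≤ f s} :=
      isClosed_le continuous_const hcont
    exact (TopologicalSpace.denseRange_denseSeq (Set.Icc t0 t1)).induction_on
      (p := fun s => (⨅ n : ℕ, f (TopologicalSpace.denseSeq (Set.Icc t0 t1) n)) ≤ f s)
      ⟨t, ht'⟩ hcl (fun n => ciInf_le hbdd n)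

lemma IsBB.aemeas (h : IsBB P t0 t1 a b B) :
    AEMeasurable (fun ω => sInf ((fun t => B t ω) '' Set.Icc t0 t1)) P := by
  have : Nonempty (Set.Icc t0 t1) := (Set.nonempty_Icc.2 h.ht.le).to_subtype
  refine ⟨fun ω => ⨅ n : ℕ, B (TopologicalSpace.denseSeq (Set.Icc t0 t1) n) ω,
    Measurable.iInf fun n => h.hmeas _, ?_⟩
  filter_upwards [h.hcont] with ω hω
  exact sInf_eq_path h.ht hω

lemma IsBB.map_Iic (h : IsBB P t0 t1 a b B) (y : ℝ) :
    P.map (fun ω => sInf ((fun t => B t ω) '' Set.Icc t0 t1)) (Set.Iic y)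
      = P {ω | ∃ t ∈ Set.Icc t0 t1, B t ω ≤ y} := by
  rw [Measure.map_apply_of_aemeasurable h.aemeas measurableSet_Iic]
  refine measure_congr ?_
  filter_upwards [h.hcont] with ω hω
  exact propext (sInf_le_iff_path h.ht hω y)

lemma IsBB.cdf_ge (h : IsBB P t0 t1 a b B) {y : ℝ} (hy : min a b ≤ y) :
    P {ω | ∃ t ∈ Set.Icc t0 t1, B t ω ≤ y} = 1 := by
  have hset : {ω | ∃ t ∈ Set.Icc t0 t1, B t ω ≤ y} =ᵐ[P] (Set.univ : Set Ω) := by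
    filter_upwards [h.start, h.finish_val] with ω h0 h1
    refine propext ⟨fun _ => trivial, fun _ => ?_⟩
    rcases min_le_iff.1 hy with hy | hy
    · exact ⟨t0, Set.left_mem_Icc.2 h.ht.le, h0.le.trans hy⟩
    · exact ⟨t1, Set.right_mem_Icc.2 h.ht.le, h1.le.trans hy⟩
  rw [measure_congr hset, measure_univ]

lemma IsBB.cdf_lt (h : IsBB P t0 t1 a b B) {y : ℝ} (hy : y < min a b) :
    P {ω | ∃ t ∈ Set.Icc t0 t1, B t ω ≤ y}
      = ENNReal.ofReal (rexp (-2 * (a - y) * (b - y) / (t1 - t0))) := by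
  obtain ⟨hya, hyb⟩ := lt_min_iff.1 hy
  refine le_antisymm ?_ (h.lower hya hyb)
  have hlim : Filter.Tendsto
      (fun y => ENNReal.ofReal (rexp (-2 * (a - y) * (b - y) / (t1 - t0)))) (nhdsWithin y (Set.Ioi y))
      (nhds (ENNReal.ofReal (rexp (-2 * (a - y) * (b - y) / (t1 - t0))))) := by
    have : Continuous
      (fun y => ENNReal.ofReal (rexp (-2 * (a - y) * (b - y) / (t1 - t0)))) :=
      ENNReal.continuous_ofReal.comp (by fun_prop)
    exact this.continuousAt.tendsto.mono_left nhdsWithin_le_nhds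
  refine ge_of_tendsto hlim ?_
  filter_upwards [Ioo_mem_nhdsGT hyb] with z hz
  refine le_trans (measure_mono_ae ?_) (h.upper hz.2)
  filter_upwards [h.finish_val] with ω hω
  rintro ⟨t, ht, hty⟩
  refine ⟨t, ⟨ht.1, lt_of_le_of_ne ht.2 ?_⟩, lt_of_le_of_lt hty hz.1⟩
  rintro rfl
  exact absurd (hω ▸ hty) (not_le.2 hyb)

lemma IsBB.main (h : IsBB P t0 t1 a b B) :
    P.map (fun ω => sInf ((fun t => B t ω) '' Set.Icc t0 t1)) =
      volume.withDensity (fun y => ENNReal.ofReal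
        (if y < min a b then
          2 / (t1 - t0) * (a + b - 2 * y) * Real.exp (-2 * (a - y) * (b - y) / (t1 - t0))
        else 0)) := by
  have : IsProbabilityMeasure (P.map (fun ω => sInf ((fun t => B t ω) '' Set.Icc t0 t1))) :=
    Measure.isProbabilityMeasure_map h.aemeas
  have hT : 0 < t1 - t0 := sub_pos.2 h.ht
  refine Measure.ext_of_Iic _ _ fun y => ?_
  rw [h.map_Iic, withDensity_apply _ measurableSet_Iic]
  rcases lt_or_ge y (min a b) with hy | hy
  · rw [h.cdf_lt hy, dens_Iic_lt a b hT hy.le]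
  · rw [h.cdf_ge hy, dens_Iic_ge a b hT hy]

end BB

/-- The minimum of a Brownian bridge from `(t0, a)` to `(t1, b)` has a law
absolutely continuous w.r.t. Lebesgue measure, with density
`(2/(t1−t0))·(a+b−2y)·exp(−2(a−y)(b−y)/(t1−t0))` for `y < min a b` and `0` otherwise.
The Brownian bridge is characterised by almost surely continuous paths together with
Gaussian finite-dimensional distributions having mean `a + ((t−t0)/(t1−t0))(b−a)` and
covariance `(s−t0)(t1−t)/(t1−t0)` for `s ≤ t`; equivalently, every finite linear
combination `∑ c i • B (ts i)` is a real Gaussian with the corresponding mean and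
variance. -/
theorem minimum_of_brownian_bridge_has_density
    {Ω : Type*} [MeasurableSpace Ω] (P : Measure Ω) [IsProbabilityMeasure P]
    (t0 t1 a b : ℝ) (ht : t0 < t1)
    (B : ℝ → Ω → ℝ)
    (hmeas : ∀ t, Measurable (B t))
    -- almost surely continuous paths
    (hcont : ∀ᵐ ω ∂P, ContinuousOn (fun t => B t ω) (Set.Icc t0 t1))
    -- Gaussian finite-dimensional distributions with the prescribed mean and covariance
    (hgauss : ∀ (n : ℕ) (ts : Fin n → ℝ) (c : Fin n → ℝ),
      (∀ i, ts i ∈ Set.Icc t0 t1) →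
      P.map (fun ω => ∑ i, c i * B (ts i) ω) =
        gaussianReal
          (∑ i, c i * (a + (ts i - t0) / (t1 - t0) * (b - a)))
          (Real.toNNReal (∑ i, ∑ j, c i * c j *
            ((min (ts i) (ts j) - t0) * (t1 - max (ts i) (ts j)) / (t1 - t0)))) ) :
    P.map (fun ω => sInf ((fun t => B t ω) '' Set.Icc t0 t1)) =
      volume.withDensity (fun y => ENNReal.ofReal
        (if y < min a b then
          2 / (t1 - t0) * (a + b - 2 * y) * Real.exp (-2 * (a - y) * (b - y) / (t1 - t0))
        else 0)) := by
  exact (IsBB.mk ht hmeas hcont hgauss).main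
end

section
/- For every real d ≥ 0, ∫_{−∞}^{0} (−8y) e^{−4y²} (1 − e^{4y(d − y)}) dy = 1/2 + √(π/8) · d · e^{d²/2} · (1 − erf(d/√2)), where erf(x) = (2/√π) ∫_0^x e^{−t²} dt. -/
open MeasureTheory Real

lemma gauss_prim_hasDerivAt (x : ℝ) :
    HasDerivAt (fun x : ℝ => ∫ s in (0 : ℝ)..x, Real.exp (-s ^ 2)) (Real.exp (-x ^ 2)) x := by
  have hc : Continuous (fun s : ℝ => Real.exp (-s ^ 2)) := by fun_prop
  exact intervalIntegral.integral_hasDerivAt_right (hc.intervalIntegrable _ _)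
    (hc.stronglyMeasurableAtFilter _ _) hc.continuousAt

lemma gauss_prim_tendsto :
    Filter.Tendsto (fun x : ℝ => ∫ s in (0 : ℝ)..x, Real.exp (-s ^ 2)) Filter.atTop
      (nhds (Real.sqrt Real.pi / 2)) := by
  have h := integral_gaussian_Ioi 1
  have hi := (integrable_exp_neg_mul_sq (b := 1) one_pos).integrableOn (s := Set.Ioi 0)
  have := intervalIntegral_tendsto_integral_Ioi (0 : ℝ) hi Filter.tendsto_id
  rw [h] at this
  simpa using this

lemma tendsto_exp_quad (a b : ℝ) (ha : 0 < a) (hb : 0 ≤ b) :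
    Filter.Tendsto (fun u : ℝ => Real.exp (-(b * u) - a * u ^ 2)) Filter.atTop (nhds 0) := by
  have h1 : Filter.Tendsto (fun u : ℝ => a * u ^ 2) Filter.atTop Filter.atTop :=
    (Filter.tendsto_pow_atTop two_ne_zero).const_mul_atTop ha
  refine Real.tendsto_exp_atBot.comp ?_
  refine Filter.tendsto_atBot_mono' _ ?_ (Filter.tendsto_neg_atTop_atBot.comp h1)
  filter_upwards [Filter.eventually_ge_atTop 0] with u hu
  have := mul_nonneg hb hu
  simp only [Function.comp]
  linarith

/-- For every `d ≥ 0`,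
`∫_{−∞}^{0} (−8y) e^{−4y²} (1 − e^{4y(d−y)}) dy
  = 1/2 + √(π/8) · d · e^{d²/2} · (1 − erf(d/√2))`,
where `erf x = (2/√π) ∫_0^x e^{−t²} dt`. -/
theorem integral_prob_first_interval_symmetric_bridge (d : ℝ) (hd : 0 ≤ d) :
    ∫ y in Set.Iio (0 : ℝ),
        (-8 * y) * Real.exp (-4 * y ^ 2) * (1 - Real.exp (4 * y * (d - y))) =
      1 / 2 + Real.sqrt (Real.pi / 8) * d * Real.exp (d ^ 2 / 2) *
        (1 - (2 / Real.sqrt Real.pi) *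
          ∫ s in (0 : ℝ)..(d / Real.sqrt 2), Real.exp (-s ^ 2)) := by
  have h2 : Real.sqrt 2 ^ 2 = 2 := Real.sq_sqrt (by norm_num)
  have h2p : 0 < Real.sqrt 2 := by positivity
  have hpp : 0 < Real.sqrt Real.pi := Real.sqrt_pos.mpr Real.pi_pos
  rw [← integral_Iic_eq_integral_Iio]
  have hflip := integral_comp_neg_Ioi (0 : ℝ)
    (fun y : ℝ => (-8 * y) * Real.exp (-4 * y ^ 2) * (1 - Real.exp (4 * y * (d - y))))
  rw [neg_zero] at hflip
  rw [← hflip]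
  set F : ℝ → ℝ := fun u => -Real.exp (-(0 * u) - 4 * u ^ 2)
    + 1 / 2 * Real.exp (-(4 * d * u) - 8 * u ^ 2)
    + d / Real.sqrt 2 * Real.exp (d ^ 2 / 2) *
      ∫ s in (0 : ℝ)..(2 * Real.sqrt 2 * u + d / Real.sqrt 2), Real.exp (-s ^ 2) with hF
  have hder : ∀ u : ℝ, HasDerivAt F
      ((-8 * -u) * Real.exp (-4 * (-u) ^ 2) * (1 - Real.exp (4 * -u * (d - -u)))) u := by
    intro u
    have e1 : HasDerivAt (fun u : ℝ => -(0 * u) - 4 * u ^ 2) (-(8 * u)) u := by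
      refine (((hasDerivAt_id' u).const_mul 0).neg.sub
        ((hasDerivAt_pow 2 u).const_mul 4)).congr_deriv ?_
      push_cast; ring
    have e2 : HasDerivAt (fun u : ℝ => -(4 * d * u) - 8 * u ^ 2) (-(4 * d) - 16 * u) u := by
      refine (((hasDerivAt_id' u).const_mul (4 * d)).neg.sub
        ((hasDerivAt_pow 2 u).const_mul 8)).congr_deriv ?_
      push_cast; ring
    have e3 : HasDerivAt (fun u : ℝ => 2 * Real.sqrt 2 * u + d / Real.sqrt 2)
        (2 * Real.sqrt 2) u := by
      simpa using ((hasDerivAt_id' u).const_mul (2 * Real.sqrt 2)).add_const (d / Real.sqrt 2)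
    have e4 := (gauss_prim_hasDerivAt (2 * Real.sqrt 2 * u + d / Real.sqrt 2)).comp u e3
    have e5 := (e1.exp.neg.add (e2.exp.const_mul (1 / 2))).add
      (e4.const_mul (d / Real.sqrt 2 * Real.exp (d ^ 2 / 2)))
    refine e5.congr_deriv ?_
    have k1 : Real.exp (-(2 * Real.sqrt 2 * u + d / Real.sqrt 2) ^ 2)
        = Real.exp (-(4 * d * u) - 8 * u ^ 2) * (Real.exp (d ^ 2 / 2))⁻¹ := by
      rw [← Real.exp_neg, ← Real.exp_add]
      congr 1
      have : (2 * Real.sqrt 2 * u + d / Real.sqrt 2) ^ 2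
        = 4 * Real.sqrt 2 ^ 2 * u ^ 2 + 4 * d * u + d ^ 2 / Real.sqrt 2 ^ 2 := by
        field_simp
        ring
      rw [this, h2]; ring
    have k2 : Real.exp (-(4 * d * u) - 8 * u ^ 2)
        = Real.exp (-4 * (-u) ^ 2) * Real.exp (4 * -u * (d - -u)) := by
      rw [← Real.exp_add]; congr 1; ring
    have k3 : Real.exp (-(0 * u) - 4 * u ^ 2) = Real.exp (-4 * (-u) ^ 2) := by
      congr 1; ring
    rw [k1, k2, k3]
    have := (Real.exp_pos (d ^ 2 / 2)).ne'
    field_simp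
    ring
  have hlim : Filter.Tendsto F Filter.atTop
      (nhds (-0 + 1 / 2 * 0 + d / Real.sqrt 2 * Real.exp (d ^ 2 / 2) *
        (Real.sqrt Real.pi / 2))) := by
    refine ((tendsto_exp_quad 4 0 (by norm_num) le_rfl).neg.add
      ((tendsto_exp_quad 8 (4 * d) (by norm_num) (by positivity)).const_mul _)).add
      (Filter.Tendsto.const_mul _ (gauss_prim_tendsto.comp ?_))
    exact Filter.tendsto_atTop_add_const_right _ _
      (Filter.tendsto_id.const_mul_atTop (by positivity))
  rw [integral_Ioi_of_hasDerivAt_of_nonneg' (fun u _ => hder u) ?_ hlim]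
  · have k8 : Real.sqrt (Real.pi / 8) = Real.sqrt Real.pi / (2 * Real.sqrt 2) := by
      rw [Real.sqrt_div Real.pi_pos.le]
      congr 1
      rw [Real.sqrt_eq_iff_mul_self_eq (by norm_num) (by positivity)]
      nlinarith
    rw [k8, hF]
    simp only [mul_zero, zero_add, neg_zero, sub_zero, ne_eq, OfNat.ofNat_ne_zero,
      not_false_eq_true, zero_pow, Real.exp_zero]
    field_simp
    ring
  · intro u hu
    have hu : 0 < u := hu
    have : Real.exp (4 * -u * (d - -u)) ≤ 1 := by
      rw [Real.exp_le_one_iff]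
      nlinarith [mul_nonneg hu.le hd, mul_pos hu hu]
    have h8 : 0 ≤ -8 * -u := by linarith
    exact mul_nonneg (mul_nonneg h8 (Real.exp_pos _).le) (by linarith)
end

section
/- Let t_j < t_{j+1}, x_j, x_{j+1} ∈ ℝ, ℓ = t_{j+1} − t_j, d = |x_{j+1} − x_j|. Let B be a Brownian bridge from (t_j, x_j) to (t_{j+1}, x_{j+1}) (a process with a.s. continuous paths whose finite-dimensional distributions are multivariate Gaussian with mean x_j + ((t−t_j)/ℓ)(x_{j+1}−x_j) and covariance (s−t_j)(t_{j+1}−t)/ℓ for s ≤ t). Assume the minimum of B is attained at an a.s. unique point, and let θ(B) be a measurable random variable with B_{θ(B)} = m(B) := min_{t∈[t_j,t_{j+1}]} B_t a.s. Then the law of the pair (m(B), θ(B)) is absolutely continuous with respect to two-dimensional Lebesgue measure, with density f(y,s) = ((x_j − y)(x_{j+1} − y) √(2ℓ) / √(π (s − t_j)³ (t_{j+1} − s)³)) · exp(d²/(2ℓ) − (x_j − y)²/(2(s − t_j)) − (x_{j+1} − y)²/(2(t_{j+1} − s))) for y < min(x_j, x_{j+1}) and t_j < s < t_{j+1}, and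 f(y,s) = 0 otherwise. -/
open MeasureTheory ProbabilityTheory Real

namespace BridgeMin

/-- Brownian bridge from `(t0,a)` to `(t1,b)`. -/
structure IsBB {Ω : Type*} [MeasurableSpace Ω] (P : Measure Ω) (t0 t1 a b : ℝ)
    (B : ℝ → Ω → ℝ) : Prop where
  lt : t0 < t1
  meas : ∀ s, Measurable (B s)
  cont : ∀ᵐ ω ∂P, ContinuousOn (fun s => B s ω) (Set.Icc t0 t1)
  gauss : ∀ (k : ℕ) (ts : Fin k → ℝ) (c : Fin k → ℝ),
      (∀ i, ts i ∈ Set.Icc t0 t1) →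
      P.map (fun ω => ∑ i, c i * B (ts i) ω) =
        gaussianReal
          (∑ i, c i * (a + (ts i - t0) / (t1 - t0) * (b - a)))
          (Real.toNNReal (∑ i, ∑ i', c i * c i' *
            ((min (ts i) (ts i') - t0) * (t1 - max (ts i) (ts i')) / (t1 - t0))))

variable {Ω : Type*} [MeasurableSpace Ω] {P : Measure Ω} {t0 t1 a b : ℝ} {B : ℝ → Ω → ℝ}

/-- time reversal -/
lemma IsBB.reverse (h : IsBB P t0 t1 a b B) :
    IsBB P t0 t1 b a (fun s => B (t0 + t1 - s)) where
  lt := h.lt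
  meas s := h.meas _
  cont := by
    filter_upwards [h.cont] with ω hω
    refine hω.comp (by fun_prop) ?_
    intro s hs
    simp only [Set.mem_Icc] at hs ⊢
    constructor <;> linarith [hs.1, hs.2]
  gauss k ts c hts := by
    have hl := h.lt
    have := h.gauss k (fun i => t0 + t1 - ts i) c (fun i => by
      have := hts i
      simp only [Set.mem_Icc] at this ⊢
      constructor <;> linarith [this.1, this.2])
    rw [this]
    have h0 : t1 - t0 ≠ 0 := by linarith
    congr 1
    · refine Finset.sum_congr rfl fun i _ => ?_
      field_simp
      ring
    · congr 1
      refine Finset.sum_congr rfl fun i _ => Finset.sum_congr rfl fun j _ => ?_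
      rw [min_sub_sub_left, max_sub_sub_left]
      congr 2
      ring

lemma IsBB.law1 (h : IsBB P t0 t1 a b B) {s : ℝ} (hs : s ∈ Set.Icc t0 t1) :
    P.map (B s) = gaussianReal (a + (s - t0) / (t1 - t0) * (b - a))
      (Real.toNNReal ((s - t0) * (t1 - s) / (t1 - t0))) := by
  have := h.gauss 1 (fun _ => s) (fun _ => 1) (fun _ => hs)
  simpa using this

lemma IsBB.law2 (h : IsBB P t0 t1 a b B) {s t : ℝ} (hs : t0 ≤ s) (hst : s ≤ t) (ht : t ≤ t1)
    (c d : ℝ) :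
    P.map (fun ω => c * B s ω + d * B t ω) = gaussianReal
      (c * (a + (s - t0) / (t1 - t0) * (b - a)) + d * (a + (t - t0) / (t1 - t0) * (b - a)))
      (Real.toNNReal (c ^ 2 * ((s - t0) * (t1 - s) / (t1 - t0)) +
        d ^ 2 * ((t - t0) * (t1 - t) / (t1 - t0)) +
        2 * c * d * ((s - t0) * (t1 - t) / (t1 - t0)))) := by
  have := h.gauss 2 ![s, t] ![c, d] (by
    intro i; fin_cases i
    · exact ⟨hs, hst.trans ht⟩
    · exact ⟨hs.trans hst, ht⟩)
  simp only [Fin.sum_univ_two, Matrix.cons_val_zero, Matrix.cons_val_one, min_self, max_self,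
    min_eq_left hst, max_eq_right hst, min_eq_right hst, max_eq_left hst] at this
  rw [this]
  congr 2
  ring

lemma IsBB.gp [IsProbabilityMeasure P] (h : IsBB P t0 t1 a b B) :
    IsGaussianProcess (fun (r : Set.Icc t0 t1) ω => B r ω) P where
  hasGaussianLaw I := by
    constructor
    have hm : Measurable (fun ω => I.restrict (fun r : Set.Icc t0 t1 => B r ω)) := by
      refine measurable_pi_lambda _ fun i => h.meas _
    refine isGaussian_of_map_eq_gaussianReal fun L => ?_
    rw [Measure.map_map (by fun_prop) hm]
    let e := (Fintype.equivFin I).symm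
    have key := h.gauss (Fintype.card I) (fun i => (e i : Set.Icc t0 t1).1)
      (fun i => L (Pi.single (e i) 1)) (fun i => (e i).1.2)
    refine ⟨_, _, Eq.trans ?_ key⟩
    congr 1
    ext ω
    simp only [Function.comp]
    rw [Equiv.sum_comp e (fun i => L (Pi.single i 1) * B i.1 ω)]
    conv_lhs => rw [← L.sum_comp_single]
    refine Finset.sum_congr rfl fun i _ => ?_
    have h2 : (Pi.single i (B i.1 ω) : I → ℝ) = B i.1 ω • (Pi.single i (1 : ℝ) : I → ℝ) := by
      ext j
      by_cases hj : j = i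
      · subst hj; simp
      · simp [hj]
    change L (Pi.single i (B i.1 ω)) = _
    rw [h2, map_smul, smul_eq_mul, mul_comm]

lemma IsBB.memLp [IsProbabilityMeasure P] (h : IsBB P t0 t1 a b B) {s : ℝ}
    (hs : s ∈ Set.Icc t0 t1) : MemLp (B s) 2 P :=
  (h.gp.hasGaussianLaw_eval ⟨s, hs⟩).memLp_two

lemma variance_of_map {X : Ω → ℝ} {m v : ℝ} (hX : Measurable X) (hv : 0 ≤ v)
    (h : P.map X = gaussianReal m v.toNNReal) : Var[X; P] = v := by
  have h1 : Var[id; P.map X] = v := by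
    rw [h, variance_id_gaussianReal, Real.coe_toNNReal _ hv]
  rw [variance_map aemeasurable_id hX.aemeasurable] at h1
  simpa using h1

lemma IsBB.cov [IsProbabilityMeasure P] (h : IsBB P t0 t1 a b B) {s t : ℝ} (hs : t0 ≤ s)
    (hst : s ≤ t) (ht : t ≤ t1) :
    cov[B s, B t; P] = (s - t0) * (t1 - t) / (t1 - t0) := by
  have hl := h.lt
  have p1 : 0 ≤ (s - t0) * (t1 - s) / (t1 - t0) :=
    div_nonneg (mul_nonneg (by linarith) (by linarith)) (by linarith)
  have p2 : 0 ≤ (t - t0) * (t1 - t) / (t1 - t0) :=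
    div_nonneg (mul_nonneg (by linarith) (by linarith)) (by linarith)
  have p3 : 0 ≤ (s - t0) * (t1 - t) / (t1 - t0) :=
    div_nonneg (mul_nonneg (by linarith) (by linarith)) (by linarith)
  have v1 := variance_of_map (h.meas s) p1 (h.law1 ⟨hs, hst.trans ht⟩)
  have v2 := variance_of_map (h.meas t) p2 (h.law1 ⟨hs.trans hst, ht⟩)
  have l3 := h.law2 hs hst ht 1 1
  have hm1 := h.meas s
  have hm2 := h.meas t
  have v3 := variance_of_map (by fun_prop) (by positivity) l3
  simp only [one_mul] at v3
  rw [variance_fun_add (h.memLp ⟨hs, hst.trans ht⟩) (h.memLp ⟨hs.trans hst, ht⟩), v1, v2] at v3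
  linarith

/-- The increment of the bridge, relative to the line from the start, is independent of the future. -/
lemma IsBB.indep [IsProbabilityMeasure P] (h : IsBB P t0 t1 a b B) {u v : ℝ} (hu : t0 < u)
    (huv : u < v) (hv : v ≤ t1) :
    IndepFun (fun ω => B u ω - (u - t0) / (v - t0) * B v ω)
      (fun ω (r : Set.Icc v t1) => B r ω) P := by
  have hl := h.lt
  let X : Unit → Ω → ℝ := fun _ ω => B u ω - (u - t0) / (v - t0) * B v ω
  let Y : Set.Icc v t1 → Ω → ℝ := fun r ω => B r ω
  have hsub : ∀ r : Set.Icc v t1, (r : ℝ) ∈ Set.Icc t0 t1 := fun r =>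
    ⟨by linarith [r.2.1], r.2.2⟩
  have key : IndepFun (fun ω s ↦ X s ω) (fun ω t ↦ Y t ω) P := by
    refine IsGaussianProcess.indepFun_of_covariance_eq_zero ?_ ?_ ?_ ?_
    · classical
      refine IsGaussianProcess.of_isGaussianProcess h.gp ?_
      rintro (s | r)
      · refine ⟨{⟨u, by constructor <;> linarith⟩, ⟨v, by constructor <;> linarith⟩},
          (ContinuousLinearMap.proj ⟨⟨u, by constructor <;> linarith⟩, by simp⟩ : _ →L[ℝ] ℝ) -
          ((u - t0) / (v - t0)) •
          (ContinuousLinearMap.proj ⟨⟨v, by constructor <;> linarith⟩, by simp⟩ : _ →L[ℝ] ℝ), ?_⟩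
        intro ω
        simp [X]
      · refine ⟨{⟨r, hsub r⟩},
          (ContinuousLinearMap.proj ⟨⟨r, hsub r⟩, by simp⟩ : _ →L[ℝ] ℝ), ?_⟩
        intro ω
        simp [Y]
    · intro s
      have := h.meas u
      have := h.meas v
      exact Measurable.aemeasurable (by fun_prop)
    · intro t
      exact (h.meas _).aemeasurable
    · intro s r
      have m1 := h.memLp (s := u) ⟨by linarith, by linarith⟩
      have m2 := h.memLp (s := v) ⟨by linarith, by linarith⟩
      have m3 := h.memLp (hsub r)
      simp only [X, Y]
      rw [covariance_fun_sub_left m1 (m2.const_mul _) m3, covariance_const_mul_left,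
        h.cov hu.le (huv.le.trans r.2.1) r.2.2, h.cov (by linarith) r.2.1 r.2.2]
      have e1 : v - t0 ≠ 0 := by linarith
      have e2 : t1 - t0 ≠ 0 := by linarith
      field_simp
      ring
  exact key.comp (measurable_pi_apply ()) measurable_id

lemma IsBB.lawZ (h : IsBB P t0 t1 a b B) {u v : ℝ} (hu : t0 < u)
    (huv : u < v) (hv : v ≤ t1) :
    P.map (fun ω => B u ω - (u - t0) / (v - t0) * B v ω) =
      gaussianReal (a * (v - u) / (v - t0)) (Real.toNNReal ((u - t0) * (v - u) / (v - t0))) := by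
  have hl := h.lt
  have := h.law2 hu.le huv.le hv 1 (-((u - t0) / (v - t0)))
  simp only [one_mul, neg_mul, ← sub_eq_add_neg] at this
  rw [this]
  have e1 : v - t0 ≠ 0 := by linarith
  have e2 : t1 - t0 ≠ 0 := by linarith
  congr 1
  · field_simp
    ring
  · congr 1
    field_simp
    ring

/-- the future sigma-algebra -/
def fut (t1 : ℝ) (B : ℝ → Ω → ℝ) (v : ℝ) : MeasurableSpace Ω :=
  MeasurableSpace.comap (fun ω (r : Set.Icc v t1) => B r ω) inferInstance

lemma fut_le (hB : ∀ s, Measurable (B s)) (v : ℝ) : fut t1 B v ≤ ‹MeasurableSpace Ω› := by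
  refine Measurable.comap_le ?_
  exact measurable_pi_lambda _ fun r => hB _

lemma measurable_fut {v r : ℝ} (h1 : v ≤ r) (h2 : r ≤ t1) : Measurable[fut t1 B v] (B r) := by
  have : B r = (fun x : Set.Icc v t1 → ℝ => x ⟨r, h1, h2⟩) ∘
    (fun ω (r : Set.Icc v t1) => B r ω) := rfl
  rw [this]
  exact (measurable_pi_apply _).comp (comap_measurable _)

lemma fut_anti {u v : ℝ} (huv : u ≤ v) : fut t1 B v ≤ fut t1 B u := by
  refine Measurable.comap_le ?_
  exact @measurable_pi_lambda _ _ _ (fut t1 B u) _ _ fun r => measurable_fut (huv.trans r.2.1) r.2.2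

/-- One step of conditioning on the future. -/
lemma IsBB.step [IsProbabilityMeasure P] (h : IsBB P t0 t1 a b B) {u v : ℝ} (hu : t0 < u)
    (huv : u < v) (hv : v ≤ t1) {E : Type*} [MeasurableSpace E] {Y : Ω → E}
    (hY : Measurable[fut t1 B v] Y) (G : ℝ → E → ENNReal)
    (hG : Measurable (Function.uncurry G)) :
    ∫⁻ ω, G (B u ω - (u - t0) / (v - t0) * B v ω) (Y ω) ∂P =
    ∫⁻ ω, ∫⁻ z, G z (Y ω) ∂(gaussianReal (a * (v - u) / (v - t0))
      (Real.toNNReal ((u - t0) * (v - u) / (v - t0)))) ∂P := by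
  have hi : IndepFun (fun ω => B u ω - (u - t0) / (v - t0) * B v ω) Y P := by
    have := h.indep hu huv hv
    rw [IndepFun_iff_Indep] at this ⊢
    exact indep_of_indep_of_le_right this hY.comap_le
  have hYm : Measurable Y := hY.mono (fut_le h.meas v) le_rfl
  have hZ : Measurable (fun ω => B u ω - (u - t0) / (v - t0) * B v ω) := by
    have := h.meas u
    have := h.meas v
    fun_prop
  rw [indepFun_iff_map_prod_eq_prod_map_map hZ.aemeasurable hYm.aemeasurable, h.lawZ hu huv hv]
    at hi
  have e1 : ∫⁻ ω, G (B u ω - (u - t0) / (v - t0) * B v ω) (Y ω) ∂P =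
    ∫⁻ p, Function.uncurry G p ∂(P.map (fun ω => (B u ω - (u - t0) / (v - t0) * B v ω, Y ω))) := by
    rw [lintegral_map hG (hZ.prodMk hYm)]
    rfl
  have : IsProbabilityMeasure (P.map Y) := Measure.isProbabilityMeasure_map hYm.aemeasurable
  rw [e1, hi, lintegral_prod_symm' _ hG, lintegral_map _ hYm]
  · rfl
  · exact hG.lintegral_prod_left'

end BridgeMin

namespace BridgeMin

/-- probability that a bridge of length `h` from `p` to `q` stays positive -/
noncomputable def gg (h p q : ℝ) : ENNReal := ENNReal.ofReal (1 - exp (-(2 * max p 0 * max q 0 / h)))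

lemma gg_of_left {h p q : ℝ} (hp : p ≤ 0) : gg h p q = 0 := by
  simp [gg, max_eq_right hp]

lemma gg_of_right {h p q : ℝ} (hp : q ≤ 0) : gg h p q = 0 := by
  simp [gg, max_eq_right hp]

lemma gg_of_pos {h p q : ℝ} (hp : 0 ≤ p) (hq : 0 ≤ q) :
    gg h p q = ENNReal.ofReal (1 - exp (-(2 * p * q / h))) := by
  simp [gg, max_eq_left hp, max_eq_left hq]

lemma gg_le_one (h p q : ℝ) : gg h p q ≤ 1 := by
  rw [gg]
  refine ENNReal.ofReal_le_one.2 ?_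
  linarith [exp_pos (-(2 * max p 0 * max q 0 / h))]

lemma gg_comm (h p q : ℝ) : gg h p q = gg h q p := by
  rw [gg, gg]; congr 4; ring

@[fun_prop]
lemma measurable_gg {E : Type*} [MeasurableSpace E] {h p q : E → ℝ} (hh : Measurable h)
    (hp : Measurable p) (hq : Measurable q) : Measurable (fun x => gg (h x) (p x) (q x)) := by
  unfold gg
  fun_prop

lemma continuous_gg {E : Type*} [TopologicalSpace E] {p q : E → ℝ} (h : ℝ)
    (hp : Continuous p) (hq : Continuous q) : Continuous (fun x => gg h (p x) (q x)) := by
  unfold gg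
  refine ENNReal.continuous_ofReal.comp ?_
  fun_prop

lemma one_sub_exp_nonneg {x : ℝ} (hx : 0 ≤ x) : 0 ≤ 1 - exp (-x) := by
  have : exp (-x) ≤ 1 := exp_le_one_iff.2 (by linarith)
  linarith

lemma integral_Ioi_add_neg {k : ℝ → ℝ} (hk : Integrable k) :
    ∫ x in Set.Ioi (0 : ℝ), (k x + k (-x)) = ∫ x, k x := by
  rw [integral_add hk.integrableOn hk.comp_neg.integrableOn, integral_comp_neg_Ioi, neg_zero,
    add_comm, intervalIntegral.integral_Iic_add_Ioi hk.integrableOn hk.integrableOn]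

lemma ck {σ h p q : ℝ} (hσ : 0 < σ) (hh : 0 < h) :
    ∫⁻ x, gg σ p x * gg h x q ∂(gaussianReal ((p * h + q * σ) / (σ + h))
      (Real.toNNReal (σ * h / (σ + h)))) = gg (σ + h) p q := by
  rcases le_or_gt p 0 with hp | hp
  · simp [gg_of_left hp]
  rcases le_or_gt q 0 with hq | hq
  · simp [gg_of_right hq]
  have hv : 0 < σ * h / (σ + h) := by positivity
  have hv' : (Real.toNNReal (σ * h / (σ + h))) ≠ 0 := by
    simpa using hv
  rw [gaussianReal_of_var_ne_zero _ hv', lintegral_withDensity_eq_lintegral_mul _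
    (measurable_gaussianPDF _ _) (by fun_prop)]
  set V := Real.toNNReal (σ * h / (σ + h)) with hV
  have hVc : (V : ℝ) = σ * h / (σ + h) := Real.coe_toNNReal _ hv.le
  set m := (p * h + q * σ) / (σ + h) with hm
  set m' := (q * σ - p * h) / (σ + h) with hm'
  set C := exp (-(2 * p * q / (σ + h))) with hC
  set k : ℝ → ℝ := fun x => gaussianPDFReal m V x - C * gaussianPDFReal m' V x with hk
  have hkint : Integrable k := (integrable_gaussianPDFReal _ _).sub
    ((integrable_gaussianPDFReal _ _).const_mul _)
  have hkk : ∀ x, k x + k (-x) = gaussianPDFReal m V x * ((1 - exp (-(2 * p * x / σ))) *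
      (1 - exp (-(2 * x * q / h)))) := by
    intro x
    have a1 : C * gaussianPDFReal m' V x = gaussianPDFReal m V x * exp (-(2 * p * x / σ)) := by
      simp only [gaussianPDFReal, hVc, hC]
      rw [mul_left_comm, ← exp_add, mul_assoc (√_)⁻¹, ← exp_add]
      congr 2
      rw [hm, hm']
      field_simp
      ring
    have a2 : C * gaussianPDFReal m' V (-x) = gaussianPDFReal m V x * exp (-(2 * x * q / h)) := by
      simp only [gaussianPDFReal, hVc, hC]
      rw [mul_left_comm, ← exp_add, mul_assoc (√_)⁻¹, ← exp_add]
      congr 2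
      rw [hm, hm']
      field_simp
      ring
    have a3 : gaussianPDFReal m V (-x) = gaussianPDFReal m V x *
        (exp (-(2 * p * x / σ)) * exp (-(2 * x * q / h))) := by
      simp only [gaussianPDFReal, hVc]
      rw [mul_assoc (√_)⁻¹, ← exp_add, ← exp_add]
      congr 2
      rw [hm]
      field_simp
      ring
    simp only [hk]
    rw [a1, a2, a3]
    ring
  have e1 : ∀ x, (gaussianPDF m V * fun x => gg σ p x * gg h x q) x =
      (Set.Ioi (0 : ℝ)).indicator (fun x => ENNReal.ofReal (k x + k (-x))) x := by
    intro x
    simp only [Pi.mul_apply]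
    by_cases hx : 0 < x
    · rw [Set.indicator_of_mem (by exact hx), hkk, ENNReal.ofReal_mul (gaussianPDFReal_nonneg _ _ _),
        ENNReal.ofReal_mul (one_sub_exp_nonneg (by positivity)), gg_of_pos hp.le hx.le,
        gg_of_pos hx.le hq.le]
      rfl
    · rw [Set.indicator_of_notMem (by exact hx), gg_of_right (not_lt.1 hx)]
      simp
  rw [lintegral_congr e1, lintegral_indicator measurableSet_Ioi,
    ← ofReal_integral_eq_lintegral_ofReal, integral_Ioi_add_neg hkint, gg_of_pos hp.le hq.le]
  · simp only [hk]
    rw [integral_sub (integrable_gaussianPDFReal _ _) ((integrable_gaussianPDFReal _ _).const_mul _),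
      integral_const_mul, integral_gaussianPDFReal_eq_one _ hv', integral_gaussianPDFReal_eq_one _ hv']
    simp [hC]
  · exact (hkint.add hkint.comp_neg).integrableOn
  · refine (ae_restrict_iff' measurableSet_Ioi).2 (ae_of_all _ fun x hx => ?_)
    have hx : 0 < x := hx
    change 0 ≤ k x + k (-x)
    rw [hkk]
    refine mul_nonneg (gaussianPDFReal_nonneg _ _ _) (mul_nonneg ?_ ?_) <;>
    exact one_sub_exp_nonneg (by positivity)

variable {Ω : Type*} [MeasurableSpace Ω] {P : Measure Ω} {t0 t1 a b : ℝ} {B : ℝ → Ω → ℝ}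

lemma IsBB.sweep [IsProbabilityMeasure P] (h : IsBB P t0 t1 a b B) {u v : ℝ} (hu : t0 < u)
    (huv : u < v) (hv : v ≤ t1) {Y : Ω → ℝ} {R : Ω → ENNReal}
    (hY : Measurable[fut t1 B v] Y) (hR : Measurable[fut t1 B v] R) :
    ∫⁻ ω, gg (u - t0) (a - Y ω) (B u ω - Y ω) * gg (v - u) (B u ω - Y ω) (B v ω - Y ω) * R ω ∂P =
    ∫⁻ ω, gg (v - t0) (a - Y ω) (B v ω - Y ω) * R ω ∂P := by
  have hBv : Measurable[fut t1 B v] (B v) := measurable_fut le_rfl hv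
  have hE : Measurable[fut t1 B v] (fun ω => (B v ω, Y ω, R ω)) := hBv.prodMk (hY.prodMk hR)
  have e1 : (0:ℝ) < u - t0 := by linarith
  have e2 : (0:ℝ) < v - u := by linarith
  have e3 : (0:ℝ) < v - t0 := by linarith
  let G : ℝ → ℝ × ℝ × ENNReal → ENNReal := fun z e =>
    gg (u - t0) (a - e.2.1) (z + (u - t0) / (v - t0) * e.1 - e.2.1) *
      gg (v - u) (z + (u - t0) / (v - t0) * e.1 - e.2.1) (e.1 - e.2.1) * e.2.2
  have hG : Measurable (Function.uncurry G) := by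
    simp only [Function.uncurry_def, G]
    fun_prop
  have key := h.step hu huv hv hE G hG
  simp only [G, sub_add_cancel] at key
  rw [key]
  refine lintegral_congr fun ω => ?_
  rw [lintegral_mul_const _ (by fun_prop)]
  congr 1
  have := ck (σ := u - t0) (h := v - u) (p := a - Y ω) (q := B v ω - Y ω) e1 e2
  rw [show u - t0 + (v - u) = v - t0 by ring] at this
  rw [← this]
  have hmap : (gaussianReal (a * (v - u) / (v - t0))
      (Real.toNNReal ((u - t0) * (v - u) / (v - t0)))).map
      (fun z => z + ((u - t0) / (v - t0) * B v ω - Y ω)) =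
      gaussianReal (((a - Y ω) * (v - u) + (B v ω - Y ω) * (u - t0)) / (v - t0))
      (Real.toNNReal ((u - t0) * (v - u) / (v - t0))) := by
    rw [gaussianReal_map_add_const]
    congr 1
    field_simp
    ring
  rw [← hmap, lintegral_map (by fun_prop) (by fun_prop)]
  simp only [add_sub_assoc]

end BridgeMin

namespace BridgeMin

open Filter Topology

/-- product of the crossing corrections along a grid -/
noncomputable def DD (u : ℕ → ℝ) (n : ℕ) (f : ℝ → ℝ) (y : ℝ) : ENNReal :=
  ∏ j ∈ Finset.range n, gg (u (j + 1) - u j) (f (u j) - y) (f (u (j + 1)) - y)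

/-- equidistant grid -/
noncomputable def gr (t0 s : ℝ) (n : ℕ) (j : ℕ) : ℝ := t0 + j * ((s - t0) / n)

lemma gr_succ_sub (t0 s : ℝ) (n j : ℕ) : gr t0 s n (j + 1) - gr t0 s n j = (s - t0) / n := by
  simp only [gr]; push_cast; ring

lemma gr_mem {t0 s : ℝ} (hs : t0 < s) {n j : ℕ} (hn : 0 < n) (hj : j ≤ n) :
    gr t0 s n j ∈ Set.Icc t0 s := by
  have hn' : (0 : ℝ) < n := by exact_mod_cast hn
  have hj' : (j : ℝ) ≤ n := by exact_mod_cast hj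
  have h0 : 0 ≤ (s - t0) / n := div_nonneg (by linarith) hn'.le
  refine ⟨?_, ?_⟩
  · simp only [gr]
    have : 0 ≤ (j : ℝ) * ((s - t0) / n) := mul_nonneg (by positivity) h0
    linarith
  · simp only [gr]
    have : (j : ℝ) * ((s - t0) / n) ≤ n * ((s - t0) / n) := mul_le_mul_of_nonneg_right hj' h0
    rw [mul_div_cancel₀ _ hn'.ne'] at this
    linarith

lemma DD_le_one (u : ℕ → ℝ) (n : ℕ) (f : ℝ → ℝ) (y : ℝ) : DD u n f y ≤ 1 :=
  Finset.prod_le_one' fun _ _ => gg_le_one _ _ _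

lemma DD_liminf {t0 s : ℝ} (hs : t0 < s) {f : ℝ → ℝ} (hf : ContinuousOn f (Set.Icc t0 s)) {y : ℝ}
    (h : ∀ r ∈ Set.Icc t0 s, y < f r) :
    Tendsto (fun n => DD (gr t0 s (n + 1)) (n + 1) f y) atTop (𝓝 1) := by
  obtain ⟨r0, hr0, hmin⟩ := isCompact_Icc.exists_isMinOn (Set.nonempty_Icc.2 hs.le) hf
  set δ := f r0 - y with hδ
  have hδ0 : 0 < δ := by have := h r0 hr0; linarith
  set c := 2 * δ * δ / (s - t0) with hc
  have hc0 : 0 < c := div_pos (by positivity) (by linarith)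
  have hlow : ∀ n : ℕ, ENNReal.ofReal (1 - (n + 1 : ℕ) * exp (-(c * (n + 1 : ℕ)))) ≤
      DD (gr t0 s (n + 1)) (n + 1) f y := by
    intro n
    have hn' : (0 : ℝ) < (n + 1 : ℕ) := by positivity
    have hx : exp (-(c * (n + 1 : ℕ))) ≤ 1 := exp_le_one_iff.2 (by
      have := mul_pos hc0 hn'; linarith)
    have hber : 1 - (n + 1 : ℕ) * exp (-(c * (n + 1 : ℕ))) ≤
        (1 - exp (-(c * (n + 1 : ℕ)))) ^ (n + 1) := by
      have := one_add_mul_le_pow (a := -exp (-(c * (n + 1 : ℕ)))) (by linarith) (n + 1)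
      simpa [sub_eq_add_neg] using this
    refine (ENNReal.ofReal_le_ofReal hber).trans ?_
    rw [ENNReal.ofReal_pow (by linarith), DD]
    conv_lhs => rw [← Finset.card_range (n + 1)]
    refine Finset.pow_card_le_prod _ _ _ fun j hj => ?_
    have hj' : j < n + 1 := Finset.mem_range.1 hj
    have b1 : δ ≤ f (gr t0 s (n + 1) j) - y := by
      have := hmin (gr_mem hs (Nat.succ_pos n) hj'.le)
      simp only [Set.mem_ofPred_eq] at this; linarith
    have b2 : δ ≤ f (gr t0 s (n + 1) (j + 1)) - y := by
      have := hmin (gr_mem hs (Nat.succ_pos n) hj')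
      simp only [Set.mem_ofPred_eq] at this; linarith
    rw [gr_succ_sub, gg_of_pos (by linarith) (by linarith), Finset.card_range]
    refine ENNReal.ofReal_le_ofReal ?_
    have : c * (n + 1 : ℕ) ≤ 2 * (f (gr t0 s (n + 1) j) - y) * (f (gr t0 s (n + 1) (j + 1)) - y) /
        ((s - t0) / (n + 1 : ℕ)) := by
      rw [hc, div_div_eq_mul_div, div_mul_eq_mul_div]
      refine div_le_div_of_nonneg_right ?_ (by linarith)
      refine mul_le_mul_of_nonneg_right ?_ hn'.le
      have := mul_le_mul b1 b2 hδ0.le (by linarith)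
      nlinarith
    have := exp_le_exp.2 (neg_le_neg this)
    linarith
  have hlim : Tendsto (fun n : ℕ => ENNReal.ofReal (1 - (n + 1 : ℕ) * exp (-(c * (n + 1 : ℕ)))))
      atTop (𝓝 1) := by
    have h1 : Tendsto (fun x : ℝ => x * exp (-(c * x))) atTop (𝓝 0) := by
      have := tendsto_rpow_mul_exp_neg_mul_atTop_nhds_zero 1 c hc0
      simpa using this
    have h2 : Tendsto (fun n : ℕ => ((n + 1 : ℕ) : ℝ)) atTop atTop :=
      tendsto_natCast_atTop_atTop.comp (tendsto_add_atTop_nat 1)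
    have h3 := (h1.comp h2).const_sub 1
    have h4 := (ENNReal.continuous_ofReal.tendsto _).comp h3
    simpa [Function.comp_def] using h4
  exact tendsto_of_tendsto_of_tendsto_of_le_of_le hlim tendsto_const_nhds hlow
    (fun n => DD_le_one _ _ _ _)

lemma DD_limsup {t0 s : ℝ} (hs : t0 < s) {f : ℝ → ℝ} (hf : ContinuousOn f (Set.Icc t0 s)) {y : ℝ}
    (h : ∃ r ∈ Set.Icc t0 s, f r < y) :
    ∀ᶠ n in atTop, DD (gr t0 s (n + 1)) (n + 1) f y = 0 := by
  obtain ⟨r, hr, hry⟩ := h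
  have hev : ∀ᶠ x in 𝓝[Set.Icc t0 s] r, f x < y := (hf r hr).eventually_lt_const hry
  obtain ⟨ε, hε, hball⟩ := Metric.mem_nhdsWithin_iff.1 hev
  have h2 : Tendsto (fun n : ℕ => (s - t0) / ((n + 1 : ℕ) : ℝ)) atTop (𝓝 0) :=
    (tendsto_natCast_atTop_atTop.comp (tendsto_add_atTop_nat 1)).const_div_atTop (s - t0)
  filter_upwards [h2.eventually_lt_const hε] with n hn
  have hn' : (0 : ℝ) < (n + 1 : ℕ) := by positivity
  have hs' : 0 < s - t0 := by linarith
  have hh : 0 < (s - t0) / (n + 1 : ℕ) := by positivity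
  set j := ⌊(r - t0) / ((s - t0) / (n + 1 : ℕ))⌋₊ with hj
  have hnn : 0 ≤ (r - t0) / ((s - t0) / (n + 1 : ℕ)) := div_nonneg (by linarith [hr.1]) hh.le
  have j1 : (j : ℝ) * ((s - t0) / (n + 1 : ℕ)) ≤ r - t0 := by
    have := Nat.floor_le hnn
    rwa [le_div_iff₀ hh] at this
  have j2 : r - t0 < (j + 1 : ℝ) * ((s - t0) / (n + 1 : ℕ)) := by
    have := Nat.lt_floor_add_one ((r - t0) / ((s - t0) / (n + 1 : ℕ)))
    rwa [div_lt_iff₀ hh] at this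
  have hjn : j ≤ n + 1 := by
    have : (j : ℝ) * ((s - t0) / (n + 1 : ℕ)) ≤ (n + 1 : ℕ) * ((s - t0) / (n + 1 : ℕ)) := by
      rw [mul_div_cancel₀ _ hn'.ne']; linarith [hr.2]
    exact_mod_cast le_of_mul_le_mul_right this hh
  have hlt : f (gr t0 s (n + 1) j) < y := by
    refine hball ⟨?_, gr_mem hs (Nat.succ_pos n) hjn⟩
    rw [Metric.mem_ball, Real.dist_eq, abs_lt]
    simp only [gr]
    constructor <;> linarith
  rcases hjn.lt_or_eq with hlt' | heq
  · exact Finset.prod_eq_zero (Finset.mem_range.2 hlt') (gg_of_left (by linarith))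
  · refine Finset.prod_eq_zero (Finset.mem_range.2 (Nat.lt_succ_self n)) (gg_of_right ?_)
    rw [heq] at hlt
    linarith

variable {Ω : Type*} [MeasurableSpace Ω] {P : Measure Ω} {t0 t1 a b : ℝ} {B : ℝ → Ω → ℝ}

lemma IsBB.start [IsProbabilityMeasure P] (h : IsBB P t0 t1 a b B) : ∀ᵐ ω ∂P, B t0 ω = a := by
  have := h.law1 (s := t0) ⟨le_rfl, h.lt.le⟩
  simp only [sub_self, zero_div, zero_mul, add_zero, Real.toNNReal_zero, gaussianReal_zero_var]
    at this
  refine ae_of_ae_map (p := fun x => x = a) (h.meas t0).aemeasurable ?_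
  rw [this, ae_dirac_eq]
  simp


lemma measurable_prod_mul {E : Type*} {mm : MeasurableSpace E} {w : ℕ → E → ENNReal} {R : E → ENNReal}
    (s : Finset ℕ) (hw : ∀ j ∈ s, Measurable[mm] (w j)) (hR : Measurable[mm] R) :
    Measurable[mm] (fun ω => (∏ j ∈ s, w j ω) * R ω) :=
  (Finset.measurable_fun_prod _ hw).mul hR

lemma IsBB.exact [IsProbabilityMeasure P] (h : IsBB P t0 t1 a b B) {u : ℕ → ℝ} (hu : StrictMono u)
    {n : ℕ} (hn : 0 < n) (h0 : u 0 = t0) (hnt : u n ≤ t1) {Y : Ω → ℝ} {R : Ω → ENNReal}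
    (hY : Measurable[fut t1 B (u n)] Y) (hR : Measurable[fut t1 B (u n)] R) :
    ∫⁻ ω, DD u n (fun s => B s ω) (Y ω) * R ω ∂P =
      ∫⁻ ω, gg (u n - t0) (a - Y ω) (B (u n) ω - Y ω) * R ω ∂P := by
  let w : ℕ → Ω → ENNReal := fun j ω => gg (u (j + 1) - u j) (B (u j) ω - Y ω) (B (u (j + 1)) ω - Y ω)
  have key : ∀ k, 1 ≤ k → k ≤ n → ∫⁻ ω, DD u n (fun s => B s ω) (Y ω) * R ω ∂P =
      ∫⁻ ω, gg (u k - t0) (a - Y ω) (B (u k) ω - Y ω) * ((∏ j ∈ Finset.Ico k n, w j ω) * R ω) ∂P := by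
    intro k hk
    induction k, hk using Nat.le_induction with
    | base =>
      intro _
      refine lintegral_congr_ae ?_
      filter_upwards [h.start] with ω hω
      rw [DD, Finset.range_eq_Ico, Finset.prod_eq_prod_Ico_succ_bot hn, mul_assoc]
      simp only [zero_add, h0, hω, w]
    | succ k hk ih =>
      intro hkn
      rw [ih (by omega)]
      have e : ∀ ω, gg (u k - t0) (a - Y ω) (B (u k) ω - Y ω) *
          ((∏ j ∈ Finset.Ico k n, w j ω) * R ω) =
          gg (u k - t0) (a - Y ω) (B (u k) ω - Y ω) *
          gg (u (k + 1) - u k) (B (u k) ω - Y ω) (B (u (k + 1)) ω - Y ω) *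
          ((∏ j ∈ Finset.Ico (k + 1) n, w j ω) * R ω) := by
        intro ω
        rw [Finset.prod_eq_prod_Ico_succ_bot (by omega)]
        simp only [w]
        ring
      rw [lintegral_congr e]
      have le1 : fut t1 B (u n) ≤ fut t1 B (u (k + 1)) := fut_anti (hu.monotone hkn)
      refine h.sweep ?_ (hu (Nat.lt_succ_self k)) ((hu.monotone hkn).trans hnt)
        (hY.mono le1 le_rfl) ?_
      · rw [← h0]; exact hu (by omega)
      · refine measurable_prod_mul _ (fun j hj => ?_) (hR.mono le1 le_rfl)
        rw [Finset.mem_Ico] at hj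
        have m1 : Measurable[fut t1 B (u (k + 1))] (B (u j)) :=
          measurable_fut (hu.monotone hj.1) ((hu.monotone hj.2.le).trans hnt)
        have m2 : Measurable[fut t1 B (u (k + 1))] (B (u (j + 1))) :=
          measurable_fut (hu.monotone (by omega)) ((hu.monotone hj.2).trans hnt)
        have m3 : Measurable[fut t1 B (u (k + 1))] Y := hY.mono le1 le_rfl
        exact @measurable_gg Ω (fut t1 B (u (k + 1))) _ _ _ measurable_const (m1.sub m3) (m2.sub m3)
  rw [key n hn le_rfl]
  simp

lemma IsBB.exact_gr [IsProbabilityMeasure P] (h : IsBB P t0 t1 a b B) {s : ℝ} (hs : t0 < s)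
    (hst : s ≤ t1) {Y : Ω → ℝ} {R : Ω → ENNReal}
    (hY : Measurable[fut t1 B s] Y) (hR : Measurable[fut t1 B s] R) (n : ℕ) :
    ∫⁻ ω, DD (gr t0 s (n + 1)) (n + 1) (fun s => B s ω) (Y ω) * R ω ∂P =
      ∫⁻ ω, gg (s - t0) (a - Y ω) (B s ω - Y ω) * R ω ∂P := by
  have hn' : (0 : ℝ) < (n + 1 : ℕ) := by positivity
  have hh : 0 < (s - t0) / (n + 1 : ℕ) := div_pos (by linarith) hn'
  have hlast : gr t0 s (n + 1) (n + 1) = s := by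
    rw [gr, mul_div_cancel₀ _ hn'.ne']; ring
  have := h.exact (u := gr t0 s (n + 1)) (n := n + 1) (Y := Y) (R := R)
    (strictMono_nat_of_lt_succ fun j => by have := gr_succ_sub t0 s (n + 1) j; linarith)
    (Nat.succ_pos n) (by simp [gr]) (by rw [hlast]; exact hst) (by rw [hlast]; exact hY)
    (by rw [hlast]; exact hR)
  rw [this, hlast]

lemma IsBB.measurable_DD (h : IsBB P t0 t1 a b B) {Y : Ω → ℝ} (hY : Measurable Y) (u : ℕ → ℝ)
    (n : ℕ) : Measurable (fun ω => DD u n (fun s => B s ω) (Y ω)) := by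
  unfold DD
  refine Finset.measurable_fun_prod _ fun j _ => ?_
  exact measurable_gg measurable_const ((h.meas _).sub hY) ((h.meas _).sub hY)

lemma IsBB.lower [IsProbabilityMeasure P] (h : IsBB P t0 t1 a b B) {s : ℝ} (hs : t0 < s)
    (hst : s ≤ t1) {Y : Ω → ℝ} {R : Ω → ENNReal}
    (hY : Measurable[fut t1 B s] Y) (hR : Measurable[fut t1 B s] R) {A : Set Ω}
    (hAm : MeasurableSet A) (hA : ∀ᵐ ω ∂P, ω ∈ A → ∀ r ∈ Set.Icc t0 s, Y ω < B r ω) :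
    ∫⁻ ω in A, R ω ∂P ≤ ∫⁻ ω, gg (s - t0) (a - Y ω) (B s ω - Y ω) * R ω ∂P := by
  have hYm : Measurable Y := hY.mono (fut_le h.meas s) le_rfl
  have hRm : Measurable R := hR.mono (fut_le h.meas s) le_rfl
  have h1 := lintegral_liminf_le (μ := P) (u := atTop)
    (f := fun n ω => DD (gr t0 s (n + 1)) (n + 1) (fun s => B s ω) (Y ω) * R ω)
    (fun n => (h.measurable_DD hYm _ _).mul hRm)
  simp only [h.exact_gr hs hst hY hR, liminf_const] at h1
  refine le_trans ?_ h1
  rw [← lintegral_indicator hAm]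
  refine lintegral_mono_ae ?_
  filter_upwards [hA, h.cont] with ω hω hc
  by_cases hωA : ω ∈ A
  · rw [Set.indicator_of_mem hωA]
    have := DD_liminf hs (hc.mono (Set.Icc_subset_Icc_right hst)) (hω hωA)
    have h2 := ENNReal.Tendsto.mul_const (b := R ω) this (Or.inl one_ne_zero)
    rw [h2.liminf_eq, one_mul]
  · rw [Set.indicator_of_notMem hωA]; exact zero_le

lemma IsBB.upper [IsProbabilityMeasure P] (h : IsBB P t0 t1 a b B) {s : ℝ} (hs : t0 < s)
    (hst : s ≤ t1) {Y : Ω → ℝ} {R : Ω → ENNReal}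
    (hY : Measurable[fut t1 B s] Y) (hR : Measurable[fut t1 B s] R) (hR1 : ∀ ω, R ω ≤ 1)
    {A : Set Ω}
    (hAm : MeasurableSet A) (hA : ∀ᵐ ω ∂P, (∀ r ∈ Set.Icc t0 s, Y ω ≤ B r ω) → ω ∈ A) :
    ∫⁻ ω, gg (s - t0) (a - Y ω) (B s ω - Y ω) * R ω ∂P ≤ ∫⁻ ω in A, R ω ∂P := by
  have hYm : Measurable Y := hY.mono (fut_le h.meas s) le_rfl
  have hRm : Measurable R := hR.mono (fut_le h.meas s) le_rfl
  have hb : ∀ n ω, DD (gr t0 s (n + 1)) (n + 1) (fun s => B s ω) (Y ω) * R ω ≤ R ω := by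
    intro n ω
    calc _ ≤ 1 * R ω := mul_le_mul_left (DD_le_one _ _ _ _) _
      _ = _ := one_mul _
  have hfin : ∫⁻ ω, R ω ∂P ≠ ⊤ := by
    refine ne_of_lt (lt_of_le_of_lt (lintegral_mono hR1) ?_)
    simp
  have h1 := limsup_lintegral_le (μ := P) R
    (f := fun n ω => DD (gr t0 s (n + 1)) (n + 1) (fun s => B s ω) (Y ω) * R ω)
    (fun n => (h.measurable_DD hYm _ _).mul hRm) (fun n => ae_of_all _ (hb n)) hfin
  simp only [h.exact_gr hs hst hY hR, limsup_const] at h1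
  refine le_trans h1 ?_
  rw [← lintegral_indicator hAm]
  refine lintegral_mono_ae ?_
  filter_upwards [hA, h.cont] with ω hω hc
  by_cases hωA : ω ∈ A
  · rw [Set.indicator_of_mem hωA]
    exact (limsup_le_limsup (Eventually.of_forall fun n => hb n ω)).trans_eq (limsup_const _)
  · rw [Set.indicator_of_notMem hωA]
    have : ∃ r ∈ Set.Icc t0 s, B r ω < Y ω := by
      by_contra hcon
      push Not at hcon
      exact hωA (hω hcon)
    have h2 := DD_limsup hs (hc.mono (Set.Icc_subset_Icc_right hst)) this
    have h3 : ∀ᶠ n in atTop, DD (gr t0 s (n + 1)) (n + 1) (fun s => B s ω) (Y ω) * R ω = 0 := by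
      filter_upwards [h2] with n hn
      rw [hn, zero_mul]
    rw [limsup_congr h3, limsup_const]

/-- The reflection principle for the bridge, conditionally on the future. -/
lemma IsBB.reflection [IsProbabilityMeasure P] (h : IsBB P t0 t1 a b B) {s : ℝ} (hs : t0 < s)
    (hst : s ≤ t1) {Y : Ω → ℝ} {R : Ω → ENNReal}
    (hY : Measurable[fut t1 B s] Y) (hR : Measurable[fut t1 B s] R) (hR1 : ∀ ω, R ω ≤ 1)
    {A : Set Ω}
    (hAm : MeasurableSet A) (hA : ∀ᵐ ω ∂P, ω ∈ A ↔ ∀ r ∈ Set.Icc t0 s, Y ω ≤ B r ω) :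
    ∫⁻ ω in A, R ω ∂P = ∫⁻ ω, gg (s - t0) (a - Y ω) (B s ω - Y ω) * R ω ∂P := by
  have hYm : Measurable Y := hY.mono (fut_le h.meas s) le_rfl
  have hRm : Measurable R := hR.mono (fut_le h.meas s) le_rfl
  refine le_antisymm ?_ (h.upper hs hst hY hR hR1 hAm (hA.mono fun ω hω => hω.2))
  have h1 : ∀ n : ℕ, ∫⁻ ω in A, R ω ∂P ≤ ∫⁻ ω, gg (s - t0) (a - (Y ω - 1 / ((n : ℝ) + 1)))
      (B s ω - (Y ω - 1 / ((n : ℝ) + 1))) * R ω ∂P := by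
    intro n
    refine h.lower (Y := fun ω => Y ω - 1 / ((n : ℝ) + 1)) hs hst (hY.sub_const _) hR hAm ?_
    filter_upwards [hA] with ω hω hωA r hr
    have := hω.1 hωA r hr
    have : (0 : ℝ) < 1 / ((n : ℝ) + 1) := by positivity
    linarith
  refine ge_of_tendsto' (tendsto_lintegral_of_dominated_convergence (fun _ => 1) ?_ ?_ ?_ ?_) h1
  · intro n
    have := h.meas s
    exact (measurable_gg measurable_const (by fun_prop) (by fun_prop)).mul hRm
  · intro n
    refine ae_of_all _ fun ω => ?_
    exact mul_le_one' (gg_le_one _ _ _) (hR1 ω)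
  · simp
  · refine ae_of_all _ fun ω => ?_
    refine ENNReal.Tendsto.mul_const ?_ (Or.inr (ne_of_lt (lt_of_le_of_lt (hR1 ω) ENNReal.one_lt_top)))
    have hc : Continuous (fun x : ℝ => gg (s - t0) (a - (Y ω - x)) (B s ω - (Y ω - x))) :=
      continuous_gg _ (by fun_prop) (by fun_prop)
    have := (hc.tendsto 0).comp tendsto_one_div_add_atTop_nhds_zero_nat
    simpa [Function.comp_def] using this

end BridgeMin

namespace BridgeMin

open Filter Topology

/-- density of the minimum of a bridge of length `h` from `x` to `b`. -/
noncomputable def kk (h b x z : ℝ) : ENNReal :=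
  if z < b ∧ z < x then ENNReal.ofReal (2 * (b + x - 2 * z) / h * exp (-(2 * (b - z) * (x - z) / h)))
  else 0

lemma measurable_kk (h b : ℝ) : Measurable (fun p : ℝ × ℝ => kk h b p.1 p.2) := by
  unfold kk
  refine Measurable.ite ?_ (by fun_prop) measurable_const
  exact (measurableSet_lt measurable_snd measurable_const).inter
    (measurableSet_lt measurable_snd measurable_fst)

lemma lintegral_ofReal_eq_sub {F f : ℝ → ℝ} {p q : ℝ} (hpq : p ≤ q)
    (hd : ∀ x ∈ Set.Icc p q, HasDerivAt F (f x) x) (hc : ContinuousOn f (Set.Icc p q))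
    (h0 : ∀ x ∈ Set.Icc p q, 0 ≤ f x) :
    ∫⁻ x in Set.Ico p q, ENNReal.ofReal (f x) = ENNReal.ofReal (F q - F p) ∧ 0 ≤ F q - F p := by
  have hi : IntervalIntegrable f volume p q := by
    apply ContinuousOn.intervalIntegrable; rwa [Set.uIcc_of_le hpq]
  have := intervalIntegral.integral_eq_sub_of_hasDerivAt (f := F) (f' := f) (a := p) (b := q)
    (by rwa [Set.uIcc_of_le hpq]) hi
  rw [← this, intervalIntegral.integral_of_le hpq]
  refine ⟨?_, setIntegral_nonneg measurableSet_Ioc fun x hx => h0 x ⟨hx.1.le, hx.2⟩⟩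
  rw [setLIntegral_congr Ico_ae_eq_Ioc,
    ofReal_integral_eq_lintegral_ofReal]
  · exact hi.1
  · refine (ae_restrict_iff' measurableSet_Ioc).2 (ae_of_all _ fun x hx => h0 x ⟨hx.1.le, hx.2⟩)

lemma lintegral_kk {h b x z : ℝ} (hh : 0 < h) :
    ∫⁻ w in Set.Ici z, kk h b x w = gg h (b - z) (x - z) := by
  by_cases hz : z < b ∧ z < x
  · set m := min b x with hm
    have hzm : z < m := lt_min hz.1 hz.2
    have hmb : m ≤ b := min_le_left _ _
    have hmx : m ≤ x := min_le_right _ _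
    have e1 : ∫⁻ w in Set.Ici z, kk h b x w = ∫⁻ w in Set.Ico z m,
        ENNReal.ofReal (2 * (b + x - 2 * w) / h * exp (-(2 * (b - w) * (x - w) / h))) := by
      rw [← lintegral_indicator measurableSet_Ici, ← lintegral_indicator measurableSet_Ico]
      refine lintegral_congr fun w => ?_
      by_cases hw : w ∈ Set.Ico z m
      · rw [Set.indicator_of_mem hw, Set.indicator_of_mem (Set.mem_Ici.2 hw.1), kk,
          if_pos ⟨hw.2.trans_le hmb, hw.2.trans_le hmx⟩]
      · rw [Set.indicator_of_notMem hw]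
        by_cases hw2 : w ∈ Set.Ici z
        · rw [Set.indicator_of_mem hw2, kk, if_neg]
          rintro ⟨h1, h2⟩
          exact hw ⟨hw2, lt_min h1 h2⟩
        · rw [Set.indicator_of_notMem hw2]
    rw [e1, (lintegral_ofReal_eq_sub (F := fun w => exp (-(2 * (b - w) * (x - w) / h))) hzm.le ?_ ?_ ?_).1]
    · rw [gg_of_pos (by linarith) (by linarith)]
      have : (b - m) * (x - m) = 0 := by
        rcases min_choice b x with h1 | h1 <;> rw [hm, h1] <;> ring
      simp only [mul_assoc, this]
      simp
    · intro w _
      have h1 : HasDerivAt (fun w => -(2 * (b - w) * (x - w) / h)) (2 * (b + x - 2 * w) / h) w := by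
        have := ((((hasDerivAt_id w).const_sub b).const_mul 2).mul
          ((hasDerivAt_id w).const_sub x)).div_const h |>.neg
        refine this.congr_deriv ?_
        simp only [id]
        ring
      refine h1.exp.congr_deriv ?_
      ring
    · fun_prop
    · intro w hw
      have := hw.2
      have : 0 ≤ 2 * (b + x - 2 * w) / h := div_nonneg (by linarith) hh.le
      positivity
  · have h0 : gg h (b - z) (x - z) = 0 := by
      rw [not_and_or] at hz
      rcases hz with hz | hz
      · exact gg_of_left (by linarith)
      · exact gg_of_right (by linarith)
    rw [h0, setLIntegral_congr_fun (g := fun _ => 0) measurableSet_Ici]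
    · simp
    · intro w hw
      simp only [kk]
      rw [if_neg]
      rintro ⟨h1, h2⟩
      exact hz ⟨lt_of_le_of_lt hw h1, lt_of_le_of_lt hw h2⟩

/-- infimum over rational times, clamped to `[p,q]` -/
noncomputable def mn {Ω : Type*} (B : ℝ → Ω → ℝ) (p q : ℝ) (ω : Ω) : ℝ :=
  ⨅ r : ℚ, B (max p (min q (r : ℝ))) ω

lemma clamp_mem {p q : ℝ} (hpq : p ≤ q) (x : ℝ) : max p (min q x) ∈ Set.Icc p q :=
  ⟨le_max_left _ _, max_le hpq (min_le_left _ _)⟩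

lemma mn_isLeast {Ω : Type*} {B : ℝ → Ω → ℝ} {p q : ℝ} (hpq : p ≤ q) {ω : Ω}
    (hc : ContinuousOn (fun s => B s ω) (Set.Icc p q)) :
    IsLeast ((fun s => B s ω) '' Set.Icc p q) (mn B p q ω) := by
  obtain ⟨r0, hr0, hmin⟩ := isCompact_Icc.exists_isMinOn (Set.nonempty_Icc.2 hpq) hc
  have hmin' : ∀ r ∈ Set.Icc p q, B r0 ω ≤ B r ω := fun r hr => hmin hr
  have hbdd : BddBelow (Set.range fun r : ℚ => B (max p (min q (r : ℝ))) ω) :=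
    ⟨B r0 ω, by rintro _ ⟨r, rfl⟩; exact hmin' _ (clamp_mem hpq _)⟩
  have hg : Continuous (fun x : ℝ => B (max p (min q x)) ω) := by
    have : Continuous (fun x : ℝ => max p (min q x)) := by fun_prop
    exact hc.comp_continuous this (clamp_mem hpq)
  have hle : ∀ x : ℝ, mn B p q ω ≤ B (max p (min q x)) ω := by
    have hcl : IsClosed {x : ℝ | mn B p q ω ≤ B (max p (min q x)) ω} :=
      isClosed_le continuous_const hg
    have hsub : Set.range ((↑) : ℚ → ℝ) ⊆ {x : ℝ | mn B p q ω ≤ B (max p (min q x)) ω} := by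
      rintro _ ⟨r, rfl⟩; exact ciInf_le hbdd r
    have h2 := closure_minimal hsub hcl
    rw [(Rat.denseRange_cast (𝕜 := ℝ)).closure_range] at h2
    intro x
    exact h2 (Set.mem_univ x)
  have heq : mn B p q ω = B r0 ω := by
    refine le_antisymm ?_ (le_ciInf fun r => hmin' _ (clamp_mem hpq _))
    have := hle r0
    rwa [min_eq_right hr0.2, max_eq_right hr0.1] at this
  rw [heq]
  exact ⟨⟨r0, hr0, rfl⟩, by rintro _ ⟨r, hr, rfl⟩; exact hmin' r hr⟩

lemma measurable_ciInf_rat {E : Type*} {mm : MeasurableSpace E} {f : ℚ → E → ℝ}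
    (hf : ∀ r, Measurable[mm] (f r)) : Measurable[mm] (fun x => ⨅ r, f r x) :=
  Measurable.iInf hf

lemma measurable_ind_one {E : Type*} {mm : MeasurableSpace E} {s : Set E}
    (hs : MeasurableSet[mm] s) : Measurable[mm] (s.indicator (1 : E → ENNReal)) :=
  measurable_one.indicator hs

lemma measurable_mn_fut {Ω : Type*} [MeasurableSpace Ω] {B : ℝ → Ω → ℝ} {s t1 : ℝ} (hs : s ≤ t1) :
    Measurable[fut t1 B s] (mn B s t1) := by
  exact measurable_ciInf_rat fun r =>
    measurable_fut (clamp_mem hs _).1 (clamp_mem hs _).2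

variable {Ω : Type*} [MeasurableSpace Ω] {P : Measure Ω} {t0 t1 a b : ℝ} {B : ℝ → Ω → ℝ}

lemma measurable_mn (hB : ∀ s, Measurable (B s)) (p q : ℝ) : Measurable (mn B p q) := by
  unfold mn
  exact Measurable.iInf fun r => hB _

lemma IsBB.mn_joint [IsProbabilityMeasure P] (h : IsBB P t0 t1 a b B) {s : ℝ} (hs : t0 < s)
    (hst : s < t1) {S : Set ℝ} (hS : MeasurableSet S) (z : ℝ) :
    P {ω | B s ω ∈ S ∧ z ≤ mn B s t1 ω} =
      ∫⁻ x in S, gg (t1 - s) (b - z) (x - z) ∂(P.map (B s)) := by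
  have hmn := measurable_mn h.meas s t1
  have hBs := h.meas s
  have hA : MeasurableSet {ω | z ≤ mn B s t1 ω} := measurableSet_le measurable_const hmn
  have hRm : MeasurableSet[fut t1 (fun s => B (t0 + t1 - s)) (t0 + t1 - s)] (B s ⁻¹' S) := by
    have := measurable_fut (t1 := t1) (B := fun s => B (t0 + t1 - s)) (v := t0 + t1 - s)
      (r := t0 + t1 - s) le_rfl (by linarith)
    simp only [sub_sub_cancel] at this
    exact this hS
  have key := h.reverse.reflection (s := t0 + t1 - s) (by linarith) (by linarith)
    (Y := fun _ => z) (R := (B s ⁻¹' S).indicator 1) measurable_const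
    (measurable_ind_one hRm)
    (fun ω => Set.indicator_le_self' (by simp) ω) hA ?_
  · rw [lintegral_indicator_one (hBs hS), Measure.restrict_apply (hBs hS)] at key
    have e : B s ⁻¹' S ∩ {ω | z ≤ mn B s t1 ω} = {ω | B s ω ∈ S ∧ z ≤ mn B s t1 ω} := rfl
    rw [e] at key
    rw [key, ← lintegral_indicator hS, lintegral_map _ hBs]
    · refine lintegral_congr fun ω => ?_
      have e2 : t0 + t1 - s - t0 = t1 - s := by ring
      simp only [sub_sub_cancel, e2]
      by_cases hω : B s ω ∈ S
      · rw [Set.indicator_of_mem hω, Set.indicator_of_mem (show ω ∈ B s ⁻¹' S from hω)]; simp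
      · rw [Set.indicator_of_notMem hω, Set.indicator_of_notMem (show ω ∉ B s ⁻¹' S from hω)]; simp
    · exact (measurable_gg measurable_const measurable_const (by fun_prop)).indicator hS
  · filter_upwards [h.cont] with ω hc
    have hl := mn_isLeast (B := B) hst.le (ω := ω) (hc.mono (Set.Icc_subset_Icc_left hs.le))
    constructor
    · intro hz r hr
      refine le_trans hz (hl.2 ⟨t0 + t1 - r, ⟨?_, ?_⟩, rfl⟩) <;> linarith [hr.1, hr.2]
    · intro hz
      obtain ⟨r, hr, hre⟩ := hl.1
      have := hz (t0 + t1 - r) ⟨by linarith [hr.2], by linarith [hr.1]⟩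
      simp only [sub_sub_cancel] at this
      show z ≤ _
      rw [← hre]; exact this

lemma IsBB.mn_law [IsProbabilityMeasure P] (h : IsBB P t0 t1 a b B) {s : ℝ} (hs : t0 < s)
    (hst : s < t1) :
    P.map (fun ω => (B s ω, mn B s t1 ω)) =
      ((P.map (B s)).prod volume).withDensity (fun p => kk (t1 - s) b p.1 p.2) := by
  have hmn := measurable_mn h.meas s t1
  have hBs := h.meas s
  have : IsProbabilityMeasure (P.map (B s)) := Measure.isProbabilityMeasure_map hBs.aemeasurable
  have : IsProbabilityMeasure (P.map (fun ω => (B s ω, mn B s t1 ω))) :=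
    Measure.isProbabilityMeasure_map (hBs.prodMk hmn).aemeasurable
  refine Measure.ext_prod fun {S T} hS hT => ?_
  have hfin : IsFiniteMeasure ((P.restrict (B s ⁻¹' S)).map (mn B s t1)) := inferInstance
  have key : (P.restrict (B s ⁻¹' S)).map (mn B s t1) =
      (volume : Measure ℝ).withDensity (fun w => ∫⁻ x in S, kk (t1 - s) b x w ∂(P.map (B s))) := by
    refine Measure.ext_of_Ici _ _ fun z => ?_
    rw [Measure.map_apply hmn measurableSet_Ici, Measure.restrict_apply (hmn measurableSet_Ici),
      withDensity_apply _ measurableSet_Ici]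
    have e : mn B s t1 ⁻¹' Set.Ici z ∩ B s ⁻¹' S = {ω | B s ω ∈ S ∧ z ≤ mn B s t1 ω} := by
      ext ω; simp [and_comm]
    rw [e, h.mn_joint hs hst hS, lintegral_lintegral_swap]
    · refine lintegral_congr fun x => ?_
      rw [lintegral_kk (by linarith)]
    · exact ((measurable_kk (t1 - s) b).comp measurable_swap).aemeasurable
  have k2 := congrArg (fun μ => μ T) key
  rw [Measure.map_apply hmn hT, Measure.restrict_apply (hmn hT), withDensity_apply _ hT] at k2
  rw [Measure.map_apply (hBs.prodMk hmn) (hS.prod hT), withDensity_apply _ (hS.prod hT),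
    ← Measure.prod_restrict, lintegral_prod_symm _ (measurable_kk _ _).aemeasurable, ← k2]
  congr 1
  ext ω; simp [and_comm]

end BridgeMin

namespace BridgeMin

open Filter Topology

/-- density of `m` on the event `θ ≥ s` -/
noncomputable def HH (t0 t1 a b s z : ℝ) : ENNReal :=
  ∫⁻ x, gg (s - t0) (a - z) (x - z) * kk (t1 - s) b x z
    ∂(gaussianReal (a + (s - t0) / (t1 - t0) * (b - a))
      (Real.toNNReal ((s - t0) * (t1 - s) / (t1 - t0))))

variable {Ω : Type*} [MeasurableSpace Ω] {P : Measure Ω} {t0 t1 a b : ℝ} {B : ℝ → Ω → ℝ}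

lemma argmin_facts {θ : ℝ} {ω : Ω} {s : ℝ} (hs : t0 < s) (hst : s < t1)
    (hc : ContinuousOn (fun s => B s ω) (Set.Icc t0 t1))
    (h1 : θ ∈ Set.Icc t0 t1) (h2 : B θ ω = mn B t0 t1 ω)
    (h3 : ∀ r ∈ Set.Icc t0 t1, B r ω = mn B t0 t1 ω → r = θ) :
    (s ≤ θ ↔ ∀ r ∈ Set.Icc t0 s, mn B s t1 ω ≤ B r ω) ∧
    (s ≤ θ → mn B s t1 ω = mn B t0 t1 ω) := by
  have l1 := mn_isLeast (B := B) (hs.trans hst).le hc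
  have l2 := mn_isLeast (B := B) hst.le (hc.mono (Set.Icc_subset_Icc_left hs.le))
  have e : s ≤ θ → mn B s t1 ω = mn B t0 t1 ω := by
    intro h
    refine le_antisymm ?_ ?_
    · rw [← h2]; exact l2.2 ⟨θ, ⟨h, h1.2⟩, rfl⟩
    · obtain ⟨r, hr, hre⟩ := l2.1
      rw [← hre]
      exact l1.2 ⟨r, ⟨hs.le.trans hr.1, hr.2⟩, rfl⟩
  refine ⟨⟨fun h r hr => ?_, fun h => ?_⟩, e⟩
  · rw [e h]
    exact l1.2 ⟨r, ⟨hr.1, hr.2.trans hst.le⟩, rfl⟩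
  · obtain ⟨r, hr, hre⟩ := l2.1
    have hr' : r ∈ Set.Icc t0 t1 := ⟨hs.le.trans hr.1, hr.2⟩
    have : r = θ := by
      refine h3 r hr' (le_antisymm ?_ (l1.2 ⟨r, hr', rfl⟩))
      obtain ⟨q, hq, hqe⟩ := l1.1
      rw [← hqe]
      simp only at hre ⊢
      rw [hre]
      rcases le_total q s with hqs | hqs
      · exact h q ⟨hq.1, hqs⟩
      · exact l2.2 ⟨q, ⟨hqs, hq.2⟩, rfl⟩
    rw [← this]; exact hr.1

lemma IsBB.joint [IsProbabilityMeasure P] (h : IsBB P t0 t1 a b B) {θ : Ω → ℝ}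
    (hθ : Measurable θ)
    (hu : ∀ᵐ ω ∂P, θ ω ∈ Set.Icc t0 t1 ∧ B (θ ω) ω = mn B t0 t1 ω ∧
      ∀ r ∈ Set.Icc t0 t1, B r ω = mn B t0 t1 ω → r = θ ω)
    {s : ℝ} (hs : t0 < s) (hst : s < t1) {A : Set ℝ} (hA : MeasurableSet A) :
    P {ω | mn B t0 t1 ω ∈ A ∧ s ≤ θ ω} = ∫⁻ z in A, HH t0 t1 a b s z := by
  have hmn := measurable_mn h.meas s t1
  have hBs := h.meas s
  have hset : MeasurableSet {ω | s ≤ θ ω} := measurableSet_le measurable_const hθ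
  have key := h.reflection hs hst.le (Y := mn B s t1) (R := (mn B s t1 ⁻¹' A).indicator 1)
    (measurable_mn_fut hst.le) (measurable_ind_one (measurable_mn_fut hst.le hA))
    (fun ω => Set.indicator_le_self' (by simp) ω) hset ?_
  · rw [lintegral_indicator_one (hmn hA), Measure.restrict_apply (hmn hA)] at key
    have e1 : P {ω | mn B t0 t1 ω ∈ A ∧ s ≤ θ ω} = P (mn B s t1 ⁻¹' A ∩ {ω | s ≤ θ ω}) := by
      refine measure_congr ?_
      filter_upwards [hu, h.cont] with ω hω hc
      have := (argmin_facts hs hst hc hω.1 hω.2.1 hω.2.2).2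
      apply propext
      show (mn B t0 t1 ω ∈ A ∧ s ≤ θ ω) ↔ (mn B s t1 ω ∈ A ∧ s ≤ θ ω)
      constructor
      · rintro ⟨h1, h2⟩; rw [this h2]; exact ⟨h1, h2⟩
      · rintro ⟨h1, h2⟩; rw [this h2] at h1; exact ⟨h1, h2⟩
    rw [e1, key]
    let F : ℝ × ℝ → ENNReal := fun p =>
      gg (s - t0) (a - p.2) (p.1 - p.2) * A.indicator 1 p.2
    have hF : Measurable F :=
      (measurable_gg measurable_const (by fun_prop) (by fun_prop)).mul
        ((measurable_ind_one hA).comp measurable_snd)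
    have hK := measurable_kk (t1 - s) b
    have : IsProbabilityMeasure (P.map (B s)) := Measure.isProbabilityMeasure_map hBs.aemeasurable
    have e2 : ∫⁻ ω, gg (s - t0) (a - mn B s t1 ω) (B s ω - mn B s t1 ω) *
        (mn B s t1 ⁻¹' A).indicator 1 ω ∂P = ∫⁻ p, F p ∂(P.map (fun ω => (B s ω, mn B s t1 ω))) := by
      rw [lintegral_map hF (hBs.prodMk hmn)]
      rfl
    rw [e2, h.mn_law hs hst, lintegral_withDensity_eq_lintegral_mul _ hK hF,
      lintegral_prod_symm _ (hK.mul hF).aemeasurable, ← lintegral_indicator hA]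
    refine lintegral_congr fun z => ?_
    simp only [Pi.mul_apply, F]
    by_cases hz : z ∈ A
    · simp only [Set.indicator_of_mem hz, Pi.one_apply, mul_one]
      rw [HH, h.law1 ⟨hs.le, hst.le⟩]
      exact lintegral_congr fun x => mul_comm _ _
    · simp [Set.indicator_of_notMem hz]
  · filter_upwards [hu, h.cont] with ω hω hc
    exact (argmin_facts hs hst hc hω.1 hω.2.1 hω.2.2).1

/-- the location of the minimum is a.s. not the right end point -/
lemma IsBB.arg_ne_right [IsProbabilityMeasure P] (h : IsBB P t0 t1 a b B) {θ : Ω → ℝ}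
    (hu : ∀ᵐ ω ∂P, θ ω ∈ Set.Icc t0 t1 ∧ B (θ ω) ω = mn B t0 t1 ω) :
    ∀ᵐ ω ∂P, θ ω ≠ t1 := by
  have hmn := measurable_mn h.meas t0 t1
  have hend : ∀ᵐ ω ∂P, B t1 ω = b := by
    have := h.reverse.start
    simpa using this
  have hset : MeasurableSet {ω | b ≤ mn B t0 t1 ω} := measurableSet_le measurable_const hmn
  have key := h.reflection h.lt le_rfl (Y := fun _ => b) (R := fun _ => 1)
    measurable_const measurable_const (fun ω => le_rfl) hset ?_
  · have z : ∫⁻ ω, gg (t1 - t0) (a - b) (B t1 ω - b) * 1 ∂P = 0 := by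
      rw [lintegral_congr_ae (g := fun _ => 0)]
      · simp
      · filter_upwards [hend] with ω hω
        rw [gg_of_right (by linarith), zero_mul]
    rw [z] at key
    simp only [lintegral_const, one_mul, Measure.restrict_apply_univ] at key
    have key2 : ∀ᵐ ω ∂P, ¬ b ≤ mn B t0 t1 ω := measure_eq_zero_iff_ae_notMem.1 key
    filter_upwards [key2, hend, hu] with ω h1 h2 h3 h4
    rw [h4, h2] at h3
    exact h1 h3.2.le
  · filter_upwards [h.cont] with ω hc
    have l1 := mn_isLeast (B := B) h.lt.le hc
    constructor
    · intro hb r hr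
      exact le_trans hb (l1.2 ⟨r, hr, rfl⟩)
    · intro hb
      obtain ⟨r, hr, hre⟩ := l1.1
      show b ≤ _
      rw [← hre]; exact hb r hr

lemma IsBB.arg_ne_left [IsProbabilityMeasure P] (h : IsBB P t0 t1 a b B) {θ : Ω → ℝ}
    (hu : ∀ᵐ ω ∂P, θ ω ∈ Set.Icc t0 t1 ∧ B (θ ω) ω = mn B t0 t1 ω) :
    ∀ᵐ ω ∂P, θ ω ≠ t0 := by
  have := h.reverse.arg_ne_right (θ := fun ω => t0 + t1 - θ ω) ?_
  · filter_upwards [this] with ω hω h1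
    exact hω (by rw [h1]; ring)
  · filter_upwards [hu, h.cont, h.reverse.cont] with ω hω hc hc'
    refine ⟨⟨by linarith [hω.1.2], by linarith [hω.1.1]⟩, ?_⟩
    simp only [sub_sub_cancel]
    rw [hω.2]
    have l1 := mn_isLeast (B := B) h.lt.le hc
    have l2 := mn_isLeast (B := fun s => B (t0 + t1 - s)) h.lt.le hc'
    have e : (fun s => B (t0 + t1 - s) ω) '' Set.Icc t0 t1 = (fun s => B s ω) '' Set.Icc t0 t1 := by
      ext y
      constructor
      · rintro ⟨r, hr, rfl⟩
        exact ⟨t0 + t1 - r, ⟨by linarith [hr.2], by linarith [hr.1]⟩, rfl⟩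
      · rintro ⟨r, hr, rfl⟩
        exact ⟨t0 + t1 - r, ⟨by linarith [hr.2], by linarith [hr.1]⟩, by simp⟩
    rw [e] at l2
    exact l1.unique l2

end BridgeMin

namespace BridgeMin

open Filter Topology

/-- Gaussian primitive -/
noncomputable def EE (w : ℝ) : ℝ := ∫ x in (0 : ℝ)..w, exp (-x ^ 2 / 2)

/-- limit of the Gaussian primitive -/
noncomputable def LL : ℝ := ∫ x in Set.Ioi (0 : ℝ), exp (-x ^ 2 / 2)

lemma EE_hasDerivAt (w : ℝ) : HasDerivAt EE (exp (-w ^ 2 / 2)) w := by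
  have hc : Continuous (fun x : ℝ => exp (-x ^ 2 / 2)) := by fun_prop
  exact intervalIntegral.integral_hasDerivAt_right (hc.intervalIntegrable _ _)
    hc.stronglyMeasurable.stronglyMeasurableAtFilter hc.continuousAt

lemma EE_neg (w : ℝ) : EE (-w) = -EE w := by
  have := intervalIntegral.integral_comp_neg (a := 0) (b := w) (fun x : ℝ => exp (-x ^ 2 / 2))
  simp only [neg_sq, neg_zero] at this
  rw [EE, EE, this, intervalIntegral.integral_symm]

lemma EE_tendsto : Tendsto EE atTop (𝓝 LL) := by
  refine intervalIntegral_tendsto_integral_Ioi 0 ?_ tendsto_id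
  have := integrable_exp_neg_mul_sq (b := 1 / 2) (by norm_num)
  refine (this.congr (ae_of_all _ fun x => ?_)).integrableOn
  simp only
  congr 1; ring

/-- exponential weight -/
noncomputable def ex (α β σ ν y : ℝ) : ℝ := exp (-(y - α) ^ 2 / (2 * σ) - (y + β) ^ 2 / (2 * ν))

/-- integrand -/
noncomputable def QQ (α β σ ν y : ℝ) : ℝ := ex α β σ ν y * (2 * (y + β) / ν)

/-- standard deviation -/
noncomputable def rr (σ ν : ℝ) : ℝ := √(σ * ν / (σ + ν))

/-- primitive of the integrand -/
noncomputable def FF (α β σ ν y : ℝ) : ℝ :=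
  -(2 * σ / (σ + ν)) * ex α β σ ν y + exp (-(α + β) ^ 2 / (2 * (σ + ν))) *
    (2 * (α + β) / (σ + ν)) * rr σ ν * EE ((y - (α * ν - β * σ) / (σ + ν)) / rr σ ν)

/-- closed form -/
noncomputable def jj (α β σ ν : ℝ) : ℝ :=
  exp (-(α + β) ^ 2 / (2 * (σ + ν))) * (α + β) *
    (LL + EE ((α * ν - β * σ) / (σ + ν) / rr σ ν))

lemma rr_pos {σ ν : ℝ} (hσ : 0 < σ) (hν : 0 < ν) : 0 < rr σ ν := sqrt_pos.2 (by positivity)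

lemma rr_sq {σ ν : ℝ} (hσ : 0 < σ) (hν : 0 < ν) : rr σ ν ^ 2 = σ * ν / (σ + ν) :=
  sq_sqrt (by positivity)

lemma ex_eq {σ ν : ℝ} (hσ : 0 < σ) (hν : 0 < ν) (α β y : ℝ) :
    exp (-(α + β) ^ 2 / (2 * (σ + ν))) *
      exp (-((y - (α * ν - β * σ) / (σ + ν)) / rr σ ν) ^ 2 / 2) = ex α β σ ν y := by
  rw [ex, ← exp_add, div_pow, rr_sq hσ hν]
  congr 1
  field_simp
  ring

lemma FF_hasDerivAt {σ ν : ℝ} (hσ : 0 < σ) (hν : 0 < ν) (α β y : ℝ) :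
    HasDerivAt (FF α β σ ν) (QQ α β σ ν y) y := by
  have hr := rr_pos hσ hν
  have h1 : HasDerivAt (fun y : ℝ => -(y - α) ^ 2 / (2 * σ) - (y + β) ^ 2 / (2 * ν))
      (-(y - α) / σ - (y + β) / ν) y := by
    have := ((((hasDerivAt_id y).sub_const α).pow 2).neg.div_const (2 * σ)).sub
      ((((hasDerivAt_id y).add_const β).pow 2).div_const (2 * ν))
    refine this.congr_deriv ?_
    simp only [id]
    push_cast
    field_simp
  have h2 := h1.exp
  have h3 : HasDerivAt (fun y : ℝ => (y - (α * ν - β * σ) / (σ + ν)) / rr σ ν) (1 / rr σ ν) y := by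
    exact ((hasDerivAt_id y).sub_const _).div_const _
  have h4 := (EE_hasDerivAt _).comp y h3
  have h5 := (h2.const_mul (-(2 * σ / (σ + ν)))).add (h4.const_mul
    (exp (-(α + β) ^ 2 / (2 * (σ + ν))) * (2 * (α + β) / (σ + ν)) * rr σ ν))
  refine h5.congr_deriv ?_
  have e := ex_eq hσ hν α β y
  have : exp (-(α + β) ^ 2 / (2 * (σ + ν))) * (2 * (α + β) / (σ + ν)) * rr σ ν *
      (exp (-((y - (α * ν - β * σ) / (σ + ν)) / rr σ ν) ^ 2 / 2) * (1 / rr σ ν)) =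
      ex α β σ ν y * (2 * (α + β) / (σ + ν)) := by
    rw [← e]
    field_simp
  rw [this, QQ]
  have e2 : exp (-(y - α) ^ 2 / (2 * σ) - (y + β) ^ 2 / (2 * ν)) = ex α β σ ν y := rfl
  rw [e2]
  field_simp
  ring

lemma FF_tendsto {σ ν : ℝ} (hσ : 0 < σ) (hν : 0 < ν) (α β : ℝ) :
    Tendsto (FF α β σ ν) atTop (𝓝 (exp (-(α + β) ^ 2 / (2 * (σ + ν))) *
    (2 * (α + β) / (σ + ν)) * rr σ ν * LL)) := by
  have hr := rr_pos hσ hν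
  have h1 : Tendsto (ex α β σ ν) atTop (𝓝 0) := by
    refine tendsto_exp_atBot.comp ?_
    have h2 : Tendsto (fun y : ℝ => (y + β) ^ 2 / (2 * ν)) atTop atTop :=
      ((tendsto_pow_atTop two_ne_zero).comp (tendsto_atTop_add_const_right _ β tendsto_id)).atTop_div_const
        (by positivity)
    refine tendsto_atBot_mono (fun y => ?_) (tendsto_neg_atTop_atBot.comp h2)
    have : 0 ≤ (y - α) ^ 2 / (2 * σ) := by positivity
    simp only [Function.comp]
    rw [neg_div]
    linarith
  have h3 : Tendsto (fun y : ℝ => (y - (α * ν - β * σ) / (σ + ν)) / rr σ ν) atTop atTop :=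
    (tendsto_atTop_add_const_right _ (-((α * ν - β * σ) / (σ + ν))) tendsto_id).atTop_div_const hr
  have := (h1.const_mul (-(2 * σ / (σ + ν)))).add ((EE_tendsto.comp h3).const_mul
    (exp (-(α + β) ^ 2 / (2 * (σ + ν))) * (2 * (α + β) / (σ + ν)) * rr σ ν))
  rw [mul_zero, zero_add] at this
  exact this

lemma lim_sub_FF {σ ν : ℝ} (hσ : 0 < σ) (hν : 0 < ν) (α β : ℝ) :
    exp (-(α + β) ^ 2 / (2 * (σ + ν))) * (2 * (α + β) / (σ + ν)) * rr σ ν * LL - FF α β σ ν 0 =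
      2 * σ / (σ + ν) * ex α β σ ν 0 + 2 * rr σ ν / (σ + ν) * jj α β σ ν := by
  rw [FF, zero_sub, neg_div (rr σ ν), EE_neg, jj]
  field_simp
  ring

lemma lintegral_Ioi_of_deriv {F f : ℝ → ℝ} {l : ℝ} (hF : ∀ x, HasDerivAt F (f x) x)
    (h0 : ∀ x ∈ Set.Ioi (0 : ℝ), 0 ≤ f x) (hl : Tendsto F atTop (𝓝 l)) :
    ∫⁻ x in Set.Ioi 0, ENNReal.ofReal (f x) = ENNReal.ofReal (l - F 0) ∧ 0 ≤ l - F 0 := by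
  have hi := integrableOn_Ioi_deriv_of_nonneg' (fun x _ => hF x) h0 hl
  have := integral_Ioi_of_hasDerivAt_of_nonneg' (fun x _ => hF x) h0 hl
  rw [← this]
  refine ⟨(ofReal_integral_eq_lintegral_ofReal hi ?_).symm, ?_⟩
  · exact (ae_restrict_iff' measurableSet_Ioi).2 (ae_of_all _ h0)
  · exact setIntegral_nonneg measurableSet_Ioi h0

lemma ex_neg {α β σ ν y : ℝ} (hσ : 0 < σ) :
    ex (-α) β σ ν y = ex α β σ ν y * exp (-(2 * α * y / σ)) := by
  rw [ex, ex, ← exp_add]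
  congr 1
  field_simp
  ring

lemma QQ_integral {α β σ ν : ℝ} (hα : 0 < α) (hβ : 0 < β) (hσ : 0 < σ) (hν : 0 < ν) :
    ∫⁻ y in Set.Ioi 0, ENNReal.ofReal (QQ α β σ ν y - QQ (-α) β σ ν y) =
      ENNReal.ofReal (2 * rr σ ν / (σ + ν) * (jj α β σ ν - jj (-α) β σ ν)) ∧
    0 ≤ 2 * rr σ ν / (σ + ν) * (jj α β σ ν - jj (-α) β σ ν) := by
  have := lintegral_Ioi_of_deriv (F := fun y => FF α β σ ν y - FF (-α) β σ ν y)
    (f := fun y => QQ α β σ ν y - QQ (-α) β σ ν y)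
    (fun y => (FF_hasDerivAt hσ hν α β y).sub (FF_hasDerivAt hσ hν (-α) β y)) ?_
    ((FF_tendsto hσ hν α β).sub (FF_tendsto hσ hν (-α) β))
  · have e1 := lim_sub_FF hσ hν α β
    have e2 := lim_sub_FF hσ hν (-α) β
    have e3 : ex (-α) β σ ν 0 = ex α β σ ν 0 := by rw [ex_neg hσ]; simp
    rw [e3] at e2
    have e : exp (-(α + β) ^ 2 / (2 * (σ + ν))) * (2 * (α + β) / (σ + ν)) * rr σ ν * LL -
        exp (-(-α + β) ^ 2 / (2 * (σ + ν))) * (2 * (-α + β) / (σ + ν)) * rr σ ν * LL -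
        (FF α β σ ν 0 - FF (-α) β σ ν 0) =
        2 * rr σ ν / (σ + ν) * (jj α β σ ν - jj (-α) β σ ν) := by linear_combination e1 - e2
    rw [e] at this
    exact this
  · intro y hy
    have hy' : 0 < y := hy
    simp only [QQ]
    rw [ex_neg hσ, ← sub_mul]
    have h1 : 0 ≤ 1 - exp (-(2 * α * y / σ)) := one_sub_exp_nonneg (by positivity)
    have h2 : 0 < ex α β σ ν y := exp_pos _
    have : 0 ≤ ex α β σ ν y * (1 - exp (-(2 * α * y / σ))) := by positivity
    have h3 : 0 ≤ 2 * (y + β) / ν := by positivity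
    refine mul_nonneg (by linarith) h3

lemma jj_hasDerivAt {T σ : ℝ} (hσ : 0 < σ) (hν : σ < T) (α β : ℝ) :
    HasDerivAt (fun σ => jj α β σ (T - σ))
      (-(ex α β σ (T - σ) 0 * (α + β) * (α * (T - σ) + β * σ) / (2 * T * rr σ (T - σ) ^ 3))) σ := by
  have hν' : 0 < T - σ := by linarith
  have hT : 0 < T := by linarith
  have hr := rr_pos hσ hν'
  have hr2 := rr_sq hσ hν'
  have e0 : ∀ σ : ℝ, σ + (T - σ) = T := fun σ => by ring
  simp only [jj, e0]
  have hv : HasDerivAt (fun σ => σ * (T - σ) / T) ((T - 2 * σ) / T) σ := by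
    refine (((hasDerivAt_id σ).mul ((hasDerivAt_id σ).const_sub T)).div_const T).congr_deriv ?_
    simp only [id]; ring
  have hrd : HasDerivAt (fun σ => rr σ (T - σ)) ((T - 2 * σ) / T / (2 * rr σ (T - σ))) σ := by
    have := hv.sqrt (by positivity)
    simp only [rr, e0]
    exact this
  have hn : HasDerivAt (fun σ => (α * (T - σ) - β * σ) / T) (-(α + β) / T) σ := by
    refine (((((hasDerivAt_id σ).const_sub T).const_mul α).sub
      ((hasDerivAt_id σ).const_mul β)).div_const T).congr_deriv ?_
    ring
  have hW : HasDerivAt (fun σ => (α * (T - σ) - β * σ) / T / rr σ (T - σ))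
      (-(α * (T - σ) + β * σ) / (2 * T * rr σ (T - σ) ^ 3)) σ := by
    refine (hn.div hrd hr.ne').congr_deriv ?_
    rw [e0] at hr2
    have hr3 : rr σ (T - σ) ^ 2 * T = σ * (T - σ) := by rw [hr2]; field_simp
    generalize rr σ (T - σ) = r at *
    field_simp
    linear_combination (-2 * (α + β)) * hr3
  have hE := ((EE_hasDerivAt _).comp σ hW).const_add LL
  have hf := hE.const_mul (exp (-(α + β) ^ 2 / (2 * T)) * (α + β))
  refine hf.congr_deriv ?_
  have ee := ex_eq hσ hν' α β 0
  rw [e0, zero_sub, neg_div (rr σ (T - σ)), neg_sq] at ee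
  rw [← ee]
  ring

end BridgeMin

namespace BridgeMin

open Filter Topology

/-- closed form of `HH` -/
noncomputable def GG (α β T σ : ℝ) : ℝ :=
  (√(2 * π))⁻¹ * exp ((β - α) ^ 2 / (2 * T)) * (2 / T) *
    (jj α β σ (T - σ) - jj (-α) β σ (T - σ))

/-- the density in shifted coordinates -/
noncomputable def ff (α β T σ : ℝ) : ℝ :=
  α * β * √(2 * T) / √(π * σ ^ 3 * (T - σ) ^ 3) *
    exp ((β - α) ^ 2 / (2 * T) - α ^ 2 / (2 * σ) - β ^ 2 / (2 * (T - σ)))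

lemma HH_eq {t0 t1 a b s z : ℝ} (hs : t0 < s) (hst : s < t1) (ha : z < a) (hb : z < b) :
    HH t0 t1 a b s z = ENNReal.ofReal (GG (a - z) (b - z) (t1 - t0) (s - t0)) ∧
      0 ≤ GG (a - z) (b - z) (t1 - t0) (s - t0) := by
  obtain ⟨α, hα⟩ : ∃ α, α = a - z := ⟨_, rfl⟩
  obtain ⟨β, hβ⟩ : ∃ β, β = b - z := ⟨_, rfl⟩
  obtain ⟨σ, hσ⟩ : ∃ σ, σ = s - t0 := ⟨_, rfl⟩
  obtain ⟨ν, hν⟩ : ∃ ν, ν = t1 - s := ⟨_, rfl⟩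
  have hα0 : 0 < α := by linarith
  have hβ0 : 0 < β := by linarith
  have hσ0 : 0 < σ := by linarith
  have hν0 : 0 < ν := by linarith
  have hT : t1 - t0 = σ + ν := by linarith
  have hr := rr_pos hσ0 hν0
  have hr2 := rr_sq hσ0 hν0
  have hQ := QQ_integral hα0 hβ0 hσ0 hν0
  set c : ℝ := (√(2 * π * (σ * ν / (σ + ν))))⁻¹ * exp ((β - α) ^ 2 / (2 * (σ + ν))) with hc
  have hc0 : 0 < c := by
    have : 0 < 2 * π * (σ * ν / (σ + ν)) := by positivity
    have := sqrt_pos.2 this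
    positivity
  have hG : GG α β (σ + ν) σ = c * (2 * rr σ ν / (σ + ν) * (jj α β σ ν - jj (-α) β σ ν)) := by
    have h1 : √(2 * π * (σ * ν / (σ + ν))) = √(2 * π) * rr σ ν := by
      rw [sqrt_mul (by positivity), rr]
    have h2 : 0 < √(2 * π) := sqrt_pos.2 (by positivity)
    rw [hc, h1, GG, add_sub_cancel_left]
    field_simp
  rw [← hα, ← hβ, ← hσ, hT, hG]
  refine ⟨?_, mul_nonneg hc0.le hQ.2⟩
  rw [ENNReal.ofReal_mul hc0.le, ← hQ.1, ← lintegral_const_mul' _ _ ENNReal.ofReal_ne_top, HH,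
    hT, ← hσ, ← hν, ← hα]
  have hv : (σ * ν / (σ + ν)).toNNReal ≠ 0 := by
    rw [Ne, Real.toNNReal_eq_zero, not_le]; positivity
  rw [gaussianReal_of_var_ne_zero _ hv, lintegral_withDensity_eq_lintegral_mul _ (by fun_prop)
    (by
      refine (measurable_gg measurable_const measurable_const (by fun_prop)).mul ?_
      exact (measurable_kk ν b).comp (measurable_id.prodMk measurable_const)),
    ← lintegral_add_right_eq_self _ z, ← lintegral_indicator measurableSet_Ioi]
  refine lintegral_congr fun y => ?_
  simp only [Pi.mul_apply, add_sub_cancel_right]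
  by_cases hy : y ∈ Set.Ioi 0
  · have hy0 : 0 < y := hy
    rw [Set.indicator_of_mem hy, kk, if_pos ⟨hb, by linarith⟩, gg_of_pos hα0.le hy0.le, gaussianPDF,
      gaussianPDFReal, ← ENNReal.ofReal_mul (one_sub_exp_nonneg (by positivity)),
      ← ENNReal.ofReal_mul (by positivity), ← ENNReal.ofReal_mul hc0.le]
    congr 1
    rw [Real.coe_toNNReal _ (by positivity), add_sub_cancel_right, ← hβ, hc, QQ, QQ, ex_neg hσ0]
    have e1 : b + (y + z) - 2 * z = β + y := by rw [hβ]; ring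
    have e2 : y + z - (a + σ / (σ + ν) * (b - a)) = y - (α + σ / (σ + ν) * (β - α)) := by
      rw [hα, hβ]; ring
    have e3 : exp (-(y - (α + σ / (σ + ν) * (β - α))) ^ 2 / (2 * (σ * ν / (σ + ν)))) *
        exp (-(2 * β * y / ν)) = exp ((β - α) ^ 2 / (2 * (σ + ν))) * ex α β σ ν y := by
      rw [ex, ← exp_add, ← exp_add]
      congr 1
      field_simp
      ring
    rw [e1, e2]
    linear_combination ((√(2 * π * (σ * ν / (σ + ν))))⁻¹ * (1 - exp (-(2 * α * y / σ))) *
      (2 * (β + y) / ν)) * e3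
  · have hy0 : y ≤ 0 := not_lt.1 hy
    rw [Set.indicator_of_notMem hy, gg_of_right hy0, zero_mul, mul_zero]

lemma HH_zero {t0 t1 a b s z : ℝ} (h : ¬ (z < a ∧ z < b)) : HH t0 t1 a b s z = 0 := by
  rw [HH, lintegral_congr (g := fun _ => 0)]
  · simp
  · intro x
    rw [not_and_or] at h
    rcases h with h | h
    · rw [gg_of_left (by linarith), zero_mul]
    · rw [kk, if_neg (fun hh => h hh.1), mul_zero]

lemma GG_hasDerivAt {α β T σ : ℝ} (hσ : 0 < σ) (hσT : σ < T) :
    HasDerivAt (GG α β T) (-ff α β T σ) σ := by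
  have hν : 0 < T - σ := by linarith
  have hT : 0 < T := by linarith
  have h := ((jj_hasDerivAt hσ hσT α β).sub (jj_hasDerivAt hσ hσT (-α) β)).const_mul
    ((√(2 * π))⁻¹ * exp ((β - α) ^ 2 / (2 * T)) * (2 / T))
  refine h.congr_deriv ?_
  have e3 : ex (-α) β σ (T - σ) 0 = ex α β σ (T - σ) 0 := by rw [ex_neg hσ]; simp
  have e4 : exp ((β - α) ^ 2 / (2 * T) - α ^ 2 / (2 * σ) - β ^ 2 / (2 * (T - σ))) =
      exp ((β - α) ^ 2 / (2 * T)) * ex α β σ (T - σ) 0 := by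
    rw [ex, ← exp_add]; congr 1; ring
  have hr := rr_pos hσ hν
  have hp : 0 < √(2 * π) := sqrt_pos.2 (by positivity)
  have e5 : √(2 * T) / √(π * σ ^ 3 * (T - σ) ^ 3) = 2 / (√(2 * π) * T * rr σ (T - σ) ^ 3) := by
    have hr2 : rr σ (T - σ) ^ 2 = σ * (T - σ) / T := by
      rw [rr_sq hσ hν, show σ + (T - σ) = T by ring]
    have hd : 0 < √(π * σ ^ 3 * (T - σ) ^ 3) := sqrt_pos.2 (by positivity)
    refine (pow_left_inj₀ (by positivity) (by positivity) two_ne_zero).1 ?_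
    have h6 : (rr σ (T - σ) ^ 3) ^ 2 = (σ * (T - σ) / T) ^ 3 := by rw [← hr2]; ring
    rw [div_pow, div_pow, mul_pow, mul_pow, h6, sq_sqrt (by positivity), sq_sqrt (by positivity),
      sq_sqrt (by positivity)]
    field_simp
  rw [ff, mul_div_assoc (α * β), e5, e4, e3]
  field_simp
  ring

lemma ff_nonneg {α β T σ : ℝ} (hα : 0 ≤ α) (hβ : 0 ≤ β) : 0 ≤ ff α β T σ := by
  unfold ff; positivity

lemma ff_continuousOn {α β T p q : ℝ} (hp : 0 < p) (hq : q < T) :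
    ContinuousOn (ff α β T) (Set.Icc p q) := by
  have h1 : ∀ x ∈ Set.Icc p q, 0 < x := fun x hx => hp.trans_le hx.1
  have h2 : ∀ x ∈ Set.Icc p q, 0 < T - x := fun x hx => by linarith [hx.2]
  unfold ff
  refine ContinuousOn.mul (ContinuousOn.div (by fun_prop) (by fun_prop) fun x hx => ?_) ?_
  · have := h1 x hx
    have := h2 x hx
    exact (sqrt_pos.2 (by positivity)).ne'
  · refine ContinuousOn.rexp (ContinuousOn.sub (ContinuousOn.sub (by fun_prop) ?_) ?_)
    · exact ContinuousOn.div (by fun_prop) (by fun_prop) fun x hx => by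
        have := h1 x hx; positivity
    · exact ContinuousOn.div (by fun_prop) (by fun_prop) fun x hx => by
        have := h2 x hx; positivity

/-- the density -/
noncomputable def dens (t0 t1 a b : ℝ) (p : ℝ × ℝ) : ENNReal := ENNReal.ofReal
        (if p.1 < min a b ∧ t0 < p.2 ∧ p.2 < t1 then
          (a - p.1) * (b - p.1) * Real.sqrt (2 * (t1 - t0)) /
            Real.sqrt (Real.pi * (p.2 - t0) ^ 3 * (t1 - p.2) ^ 3) *
          Real.exp (|b - a| ^ 2 / (2 * (t1 - t0)) -
            (a - p.1) ^ 2 / (2 * (p.2 - t0)) - (b - p.1) ^ 2 / (2 * (t1 - p.2)))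
        else 0)

lemma measurable_dens (t0 t1 a b : ℝ) : Measurable (dens t0 t1 a b) := by
  unfold dens
  refine ENNReal.measurable_ofReal.comp (Measurable.ite ?_ (by fun_prop) measurable_const)
  exact (measurableSet_lt measurable_fst measurable_const).inter
    ((measurableSet_lt measurable_const measurable_snd).inter
      (measurableSet_lt measurable_snd measurable_const))

lemma HH_split {t0 t1 a b s r : ℝ} (hs : t0 < s) (hsr : s ≤ r) (hr : r < t1) (z : ℝ) :
    HH t0 t1 a b s z = (∫⁻ u in Set.Ico s r, dens t0 t1 a b (z, u)) + HH t0 t1 a b r z := by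
  by_cases hz : z < a ∧ z < b
  · obtain ⟨h1, h1'⟩ := HH_eq (b := b) hs (hsr.trans_lt hr) hz.1 hz.2
    obtain ⟨h2, h2'⟩ := HH_eq (b := b) (hs.trans_le hsr) hr hz.1 hz.2
    have h3 : ∫⁻ u in Set.Ico s r, dens t0 t1 a b (z, u) =
        ∫⁻ u in Set.Ico s r, ENNReal.ofReal (ff (a - z) (b - z) (t1 - t0) (u - t0)) := by
      refine setLIntegral_congr_fun measurableSet_Ico fun u hu => ?_
      simp only [dens]
      rw [if_pos ⟨lt_min hz.1 hz.2, hs.trans_le hu.1, hu.2.trans hr⟩, ff, sq_abs,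
        sub_sub_sub_cancel_right, sub_sub_sub_cancel_right]
    have h40 := lintegral_ofReal_eq_sub (F := fun u => -GG (a - z) (b - z) (t1 - t0) (u - t0))
      (f := fun u => ff (a - z) (b - z) (t1 - t0) (u - t0)) hsr ?_ ?_ ?_
    · obtain ⟨h4, h0⟩ := h40
      rw [h1, h2, h3, h4, ← ENNReal.ofReal_add h0 h2']
      congr 1
      ring
    · intro u hu
      have := (GG_hasDerivAt (α := a - z) (β := b - z) (T := t1 - t0) (σ := u - t0)
        (by linarith [hu.1]) (by linarith [hu.2])).neg
      rw [neg_neg] at this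
      exact this.comp_sub_const u t0
    · exact (ff_continuousOn (p := s - t0) (q := r - t0) (by linarith) (by linarith)).comp
        (by fun_prop) (fun u hu => ⟨by linarith [hu.1], by linarith [hu.2]⟩)
    · intro u _
      exact ff_nonneg (by linarith) (by linarith)
  · rw [HH_zero hz, HH_zero hz, add_zero, lintegral_congr (g := fun _ => 0)]
    · simp
    · intro u
      rw [dens, if_neg, ENNReal.ofReal_zero]
      rintro ⟨h1, -⟩
      exact hz (lt_min_iff.1 h1)

end BridgeMin

namespace BridgeMin

open Filter Topology

variable {Ω : Type*} [MeasurableSpace Ω] {P : Measure Ω} {t0 t1 a b : ℝ} {B : ℝ → Ω → ℝ}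

lemma IsBB.joint_Ico [IsProbabilityMeasure P] (h : IsBB P t0 t1 a b B) {θ : Ω → ℝ}
    (hθ : Measurable θ)
    (hu : ∀ᵐ ω ∂P, θ ω ∈ Set.Icc t0 t1 ∧ B (θ ω) ω = mn B t0 t1 ω ∧
      ∀ r ∈ Set.Icc t0 t1, B r ω = mn B t0 t1 ω → r = θ ω)
    {s r : ℝ} (hs : t0 < s) (hsr : s ≤ r) (hr : r < t1) {A : Set ℝ} (hA : MeasurableSet A) :
    P {ω | mn B t0 t1 ω ∈ A ∧ θ ω ∈ Set.Ico s r} =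
      ∫⁻ u in Set.Ico s r, ∫⁻ z in A, dens t0 t1 a b (z, u) := by
  have hmn := measurable_mn h.meas t0 t1
  have j1 := h.joint hθ hu hs (hsr.trans_lt hr) hA
  have j2 := h.joint hθ hu (hs.trans_le hsr) hr hA
  have hd := measurable_dens t0 t1 a b
  have e1 : {ω | mn B t0 t1 ω ∈ A ∧ s ≤ θ ω} =
      {ω | mn B t0 t1 ω ∈ A ∧ θ ω ∈ Set.Ico s r} ∪ {ω | mn B t0 t1 ω ∈ A ∧ r ≤ θ ω} := by
    ext ω
    simp only [Set.mem_union, Set.mem_Ico]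
    constructor
    · rintro ⟨h1, h2⟩
      rcases lt_or_ge (θ ω) r with h3 | h3
      · exact Or.inl ⟨h1, h2, h3⟩
      · exact Or.inr ⟨h1, h3⟩
    · rintro (⟨h1, h2, h3⟩ | ⟨h1, h2⟩)
      · exact ⟨h1, h2⟩
      · exact ⟨h1, hsr.trans h2⟩
  have hdis : Disjoint {ω | mn B t0 t1 ω ∈ A ∧ θ ω ∈ Set.Ico s r}
      {ω | mn B t0 t1 ω ∈ A ∧ r ≤ θ ω} := by
    rw [Set.disjoint_left]
    rintro ω ⟨_, h2⟩ ⟨_, h3⟩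
    exact absurd h2.2 (not_lt.2 h3)
  have hm2 : MeasurableSet {ω | mn B t0 t1 ω ∈ A ∧ r ≤ θ ω} :=
    (hmn hA).inter (measurableSet_le measurable_const hθ)
  rw [e1, measure_union hdis hm2] at j1
  simp only [HH_split hs hsr hr] at j1
  rw [lintegral_add_left, ← j2, lintegral_lintegral_swap (f := fun z u => dens t0 t1 a b (z, u)) hd.aemeasurable] at j1
  · exact (ENNReal.add_left_inj (measure_ne_top _ _)).1 j1
  · exact hd.lintegral_prod_right'

lemma Ioo_eq_iUnion (t0 t1 : ℝ) :
    Set.Ioo t0 t1 = ⋃ i : {pq : ℚ × ℚ // t0 < pq.1 ∧ (pq.2 : ℝ) < t1},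
      Set.Ico (i.1.1 : ℝ) (i.1.2 : ℝ) := by
  ext x
  simp only [Set.mem_iUnion]
  constructor
  · rintro ⟨h1, h2⟩
    obtain ⟨p, hp1, hp2⟩ := exists_rat_btwn h1
    obtain ⟨q, hq1, hq2⟩ := exists_rat_btwn h2
    exact ⟨⟨(p, q), hp1, hq2⟩, hp2.le, hq1⟩
  · rintro ⟨⟨⟨p, q⟩, h1, h2⟩, h3, h4⟩
    exact ⟨h1.trans_le h3, h4.trans h2⟩

lemma IsBB.main [IsProbabilityMeasure P] (h : IsBB P t0 t1 a b B) {θ : Ω → ℝ}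
    (hθ : Measurable θ)
    (hu : ∀ᵐ ω ∂P, θ ω ∈ Set.Icc t0 t1 ∧ B (θ ω) ω = mn B t0 t1 ω ∧
      ∀ r ∈ Set.Icc t0 t1, B r ω = mn B t0 t1 ω → r = θ ω) :
    P.map (fun ω => (mn B t0 t1 ω, θ ω)) = (volume : Measure (ℝ × ℝ)).withDensity (dens t0 t1 a b) := by
  have hmn := measurable_mn h.meas t0 t1
  have hd := measurable_dens t0 t1 a b
  have : IsProbabilityMeasure (P.map (fun ω => (mn B t0 t1 ω, θ ω))) :=
    Measure.isProbabilityMeasure_map (hmn.prodMk hθ).aemeasurable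
  refine Measure.ext_prod fun {S T} hS hT => ?_
  have key : (P.restrict (mn B t0 t1 ⁻¹' S)).map θ =
      (volume : Measure ℝ).withDensity (fun u => ∫⁻ z in S, dens t0 t1 a b (z, u)) := by
    have hr1 : ((P.restrict (mn B t0 t1 ⁻¹' S)).map θ).restrict (Set.Ioo t0 t1) =
        (P.restrict (mn B t0 t1 ⁻¹' S)).map θ := by
      refine Measure.restrict_eq_self_of_ae_mem ?_
      refine (ae_map_iff hθ.aemeasurable (p := fun x => x ∈ Set.Ioo t0 t1) measurableSet_Ioo).2 ?_
      refine ae_restrict_of_ae ?_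
      have hu' : ∀ᵐ ω ∂P, θ ω ∈ Set.Icc t0 t1 ∧ B (θ ω) ω = mn B t0 t1 ω :=
        hu.mono fun ω hω => ⟨hω.1, hω.2.1⟩
      filter_upwards [hu', h.arg_ne_left hu', h.arg_ne_right hu'] with ω h1 h2 h3
      exact ⟨lt_of_le_of_ne h1.1.1 (Ne.symm h2), lt_of_le_of_ne h1.1.2 h3⟩
    have hr2 : ((volume : Measure ℝ).withDensity
        (fun u => ∫⁻ z in S, dens t0 t1 a b (z, u))).restrict (Set.Ioo t0 t1) =
        (volume : Measure ℝ).withDensity (fun u => ∫⁻ z in S, dens t0 t1 a b (z, u)) := by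
      rw [restrict_withDensity measurableSet_Ioo, ← withDensity_indicator measurableSet_Ioo]
      congr 1
      ext u
      by_cases hu : u ∈ Set.Ioo t0 t1
      · rw [Set.indicator_of_mem hu]
      · rw [Set.indicator_of_notMem hu, lintegral_congr (g := fun _ => 0)]
        · simp
        · intro z
          rw [dens, if_neg, ENNReal.ofReal_zero]
          rintro ⟨_, h1⟩
          exact hu h1
    rw [← hr1, ← hr2, Ioo_eq_iUnion, Measure.restrict_iUnion_congr]
    rintro ⟨⟨p, q⟩, hp, hq⟩
    simp only at hp hq ⊢
    refine Measure.ext_of_Ici _ _ fun x => ?_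
    rw [Measure.restrict_apply measurableSet_Ici, Measure.restrict_apply measurableSet_Ici]
    have e : Set.Ici x ∩ Set.Ico (p : ℝ) q = Set.Ico (max x p) q := by
      ext y; simp [and_assoc]
    rw [e]
    rcases le_total (max x (p : ℝ)) q with hle | hle
    · rw [Measure.map_apply hθ measurableSet_Ico, withDensity_apply _ measurableSet_Ico,
        Measure.restrict_apply (hθ measurableSet_Ico),
        ← h.joint_Ico hθ hu (hp.trans_le (le_max_right _ _)) hle hq hS]
      congr 1
      ext ω
      simp only [Set.mem_inter_iff, Set.mem_preimage]
      exact and_comm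
    · rw [Set.Ico_eq_empty (not_lt.2 hle)]
      simp
  have k2 := congrArg (fun μ => μ T) key
  rw [Measure.map_apply hθ hT, Measure.restrict_apply (hθ hT), withDensity_apply _ hT] at k2
  rw [Measure.map_apply (hmn.prodMk hθ) (hS.prod hT), withDensity_apply _ (hS.prod hT),
    Measure.volume_eq_prod, ← Measure.prod_restrict, lintegral_prod_symm _ hd.aemeasurable, ← k2]
  congr 1
  ext ω; simp [and_comm]

end BridgeMin


/-- Joint density of the minimum and its location for a Brownian
bridge `B` from `(tj, xj)` to `(tj1, xj1)`: with `ℓ = tj1 − tj` and `d = |xj1 − xj|`, the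
law of `(m(B), θ(B))` has density
`f(y,s) = ((xj−y)(xj1−y)√(2ℓ)/√(π(s−tj)³(tj1−s)³))·exp(d²/(2ℓ) − (xj−y)²/(2(s−tj)) −
(xj1−y)²/(2(tj1−s)))` for `y < min(xj,xj1)`, `tj < s < tj1`, and `0` otherwise. -/
theorem joint_density_min_and_argmin_of_bridge
    {Ω : Type*} [MeasurableSpace Ω] (P : Measure Ω) [IsProbabilityMeasure P]
    (tj tj1 xj xj1 : ℝ) (ht : tj < tj1)
    (B : ℝ → Ω → ℝ)
    (hmeas : ∀ s, Measurable (B s))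
    -- almost surely continuous paths
    (hcont : ∀ᵐ ω ∂P, ContinuousOn (fun s => B s ω) (Set.Icc tj tj1))
    -- Gaussian finite-dimensional distributions with the bridge mean and covariance
    (hgauss : ∀ (k : ℕ) (ts : Fin k → ℝ) (c : Fin k → ℝ),
      (∀ i, ts i ∈ Set.Icc tj tj1) →
      P.map (fun ω => ∑ i, c i * B (ts i) ω) =
        gaussianReal
          (∑ i, c i * (xj + (ts i - tj) / (tj1 - tj) * (xj1 - xj)))
          (Real.toNNReal (∑ i, ∑ i', c i * c i' *
            ((min (ts i) (ts i') - tj) * (tj1 - max (ts i) (ts i')) / (tj1 - tj)))))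
    -- m is the minimum of B
    (m : Ω → ℝ) (hm : ∀ ω, m ω = sInf ((fun s => B s ω) '' Set.Icc tj tj1))
    -- the minimum is attained at an a.s. unique point, selected measurably by θ
    (huniq : ∀ᵐ ω ∂P, ∃! s, s ∈ Set.Icc tj tj1 ∧
      IsMinOn (fun u => B u ω) (Set.Icc tj tj1) s)
    (θ : Ω → ℝ) (hθmeas : Measurable θ)
    (hθ : ∀ᵐ ω ∂P, θ ω ∈ Set.Icc tj tj1 ∧ B (θ ω) ω = m ω) :
    P.map (fun ω => (m ω, θ ω)) =
      (volume : Measure (ℝ × ℝ)).withDensity (fun p => ENNReal.ofReal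
        (if p.1 < min xj xj1 ∧ tj < p.2 ∧ p.2 < tj1 then
          (xj - p.1) * (xj1 - p.1) * Real.sqrt (2 * (tj1 - tj)) /
            Real.sqrt (Real.pi * (p.2 - tj) ^ 3 * (tj1 - p.2) ^ 3) *
          Real.exp (|xj1 - xj| ^ 2 / (2 * (tj1 - tj)) -
            (xj - p.1) ^ 2 / (2 * (p.2 - tj)) - (xj1 - p.1) ^ 2 / (2 * (tj1 - p.2)))
        else 0)) := by
  have h : BridgeMin.IsBB P tj tj1 xj xj1 B := ⟨ht, hmeas, hcont, hgauss⟩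
  have hme : ∀ᵐ ω ∂P, m ω = BridgeMin.mn B tj tj1 ω := by
    filter_upwards [hcont] with ω hc
    rw [hm ω]
    exact (BridgeMin.mn_isLeast ht.le hc).csInf_eq
  have hu : ∀ᵐ ω ∂P, θ ω ∈ Set.Icc tj tj1 ∧ B (θ ω) ω = BridgeMin.mn B tj tj1 ω ∧
      ∀ r ∈ Set.Icc tj tj1, B r ω = BridgeMin.mn B tj tj1 ω → r = θ ω := by
    filter_upwards [hcont, hme, huniq, hθ] with ω hc h1 h2 h3
    have hl := BridgeMin.mn_isLeast ht.le hc
    have key : ∀ r ∈ Set.Icc tj tj1, B r ω = BridgeMin.mn B tj tj1 ω →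
        r ∈ Set.Icc tj tj1 ∧ IsMinOn (fun u => B u ω) (Set.Icc tj tj1) r := by
      intro r hr hr2
      refine ⟨hr, ?_⟩
      rw [isMinOn_iff]
      intro x hx
      simp only [hr2]
      exact hl.2 ⟨x, hx, rfl⟩
    have h4 : B (θ ω) ω = BridgeMin.mn B tj tj1 ω := h3.2.trans h1
    exact ⟨h3.1, h4, fun r hr hr2 => h2.unique (key r hr hr2) (key _ h3.1 h4)⟩
  have e : P.map (fun ω => (m ω, θ ω)) = P.map (fun ω => (BridgeMin.mn B tj tj1 ω, θ ω)) := by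
    refine Measure.map_congr ?_
    filter_upwards [hme] with ω hω
    rw [hω]
  rw [e]
  exact h.main hθmeas hu
end
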